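/- arXiv:1404.2928 — 7 statements merged into one kernel-verified Lean document; each statement's English description precedes it below -/
import Mathlib

section
/- One has the identity ∫_0^∞ ν([s,∞)) G(s) ds = 1/2. -/
open MeasureTheory Filter

lemma integrable_abs_pow_of_integrable_exp_mul_abs {ν : Measure ℝ}
    {c : ℝ} (hc : 0 < c) (h : Integrable (fun x => Real.exp (c * |x|)) ν) (n : ℕ) :
    Integrable (fun x : ℝ => |x| ^ n) ν := by
  refine Integrable.mono' (h.const_mul (n.factorial / c ^ n)) (by fun_prop) ?_
  refine Eventually.of_forall fun x => ?_
  have h1 := Real.pow_div_factorial_le_exp (c * |x|) (by positivity) n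
  rw [Real.norm_of_nonneg (by positivity)]
  have hf : (0 : ℝ) < n.factorial := by positivity
  rw [div_le_iff₀ hf, mul_pow] at h1
  rw [div_mul_eq_mul_div, le_div_iff₀ (by positivity)]
  linarith

section LinearGrowth

variable {H : ℝ → ℝ} {C : ℝ}

lemma intervalIntegrable_of_linear_growth (hm : Measurable H)
    (hb : ∀ u, |H u| ≤ C * (1 + |u|)) (a b : ℝ) : IntervalIntegrable H volume a b := by
  have h : IntervalIntegrable (fun u : ℝ => C * (1 + |u|)) volume a b :=
    Continuous.intervalIntegrable (by fun_prop) a b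
  exact h.mono_fun' hm.aestronglyMeasurable (Eventually.of_forall hb)

lemma continuous_primitive_of_linear_growth (hm : Measurable H)
    (hb : ∀ u, |H u| ≤ C * (1 + |u|)) : Continuous fun x => ∫ u in (0 : ℝ)..x, H u :=
  intervalIntegral.continuous_primitive (intervalIntegrable_of_linear_growth hm hb) 0

lemma abs_le_abs_of_mem_uIoc_zero {u y : ℝ} (hu : u ∈ Set.uIoc 0 y) : |u| ≤ |y| := by
  rcases le_total 0 y with h | h
  · rw [Set.uIoc_of_le h] at hu
    rw [abs_of_pos hu.1, abs_of_nonneg h]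
    exact hu.2
  · rw [Set.uIoc_of_ge h] at hu
    rw [abs_of_nonpos hu.2, abs_of_nonpos h]
    linarith [hu.1]

lemma primitive_add_sub (hm : Measurable H) (hb : ∀ u, |H u| ≤ C * (1 + |u|)) (T z : ℝ) :
    (∫ u in (0 : ℝ)..(T + z), H u) - ∫ u in (0 : ℝ)..T, H u = ∫ u in (0 : ℝ)..z, H (T + u) := by
  rw [intervalIntegral.integral_interval_sub_left
    (intervalIntegrable_of_linear_growth hm hb _ _)
    (intervalIntegrable_of_linear_growth hm hb _ _),
    intervalIntegral.integral_comp_add_left, add_zero]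

lemma abs_integral_shift_le (hC : 0 ≤ C) (hb : ∀ u, |H u| ≤ C * (1 + |u|)) (T z : ℝ) :
    |∫ u in (0 : ℝ)..z, H (T + u)| ≤ C * (1 + |T| + |z|) * |z| := by
  have := intervalIntegral.norm_integral_le_of_norm_le_const (a := 0) (b := z)
    (f := fun u => H (T + u)) (C := C * (1 + |T| + |z|)) (fun u hu => by
      have h1 := abs_le_abs_of_mem_uIoc_zero hu
      have h2 := abs_add_le T u
      exact (hb _).trans (mul_le_mul_of_nonneg_left (by linarith) hC))
  simpa using this

/-- The integrated renewal relation: the expected increment of the primitive of `H` over a step is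
the same from every starting point. -/
lemma integral_primitive_eq_integral_increment {ν : Measure ℝ} [IsProbabilityMeasure ν]
    (h1 : Integrable (fun x : ℝ => |x|) ν) (h2 : Integrable (fun x : ℝ => |x| ^ 2) ν)
    (hm : Measurable H) (hC : 0 ≤ C) (hb : ∀ u, |H u| ≤ C * (1 + |u|))
    (hren : ∀ s, 0 ≤ s → H s = ∫ z, H (s + z) ∂ν) {T : ℝ} (hT : 0 ≤ T) :
    ∫ z, (∫ u in (0 : ℝ)..z, H u) ∂ν = ∫ z, (∫ u in (0 : ℝ)..z, H (T + u)) ∂ν := by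
  have hi : ∀ S : ℝ, Integrable (fun z => ∫ u in (0 : ℝ)..z, H (S + u)) ν := by
    intro S
    have hc : Continuous (fun z => ∫ u in (0 : ℝ)..z, H (S + u)) := by
      simp_rw [← primitive_add_sub hm hb]
      exact ((continuous_primitive_of_linear_growth hm hb).comp (by fun_prop)).sub
        continuous_const
    refine Integrable.mono' (((h1.const_mul (1 + |S|)).add h2).const_mul C)
      hc.aestronglyMeasurable (Eventually.of_forall fun z => ?_)
    refine (abs_integral_shift_le hC hb S z).trans (le_of_eq ?_)
    simp only [Pi.add_apply]
    ring
  have hi0 : Integrable (fun z => ∫ u in (0 : ℝ)..z, H u) ν := by simpa using hi 0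
  have hswap : ∫ s in (0 : ℝ)..T, ∫ z, H (s + z) ∂ν = ∫ z, (∫ s in (0 : ℝ)..T, H (s + z)) ∂ν := by
    rw [intervalIntegral.integral_of_le hT, integral_integral_swap]
    · simp_rw [intervalIntegral.integral_of_le hT]
    · have hb' : Integrable (fun z : ℝ => C * (1 + T + |z|)) ν :=
        ((integrable_const _).add h1).const_mul C
      refine Integrable.mono' (hb'.comp_snd (volume.restrict (Set.Ioc 0 T)))
        (hm.comp measurable_add).aestronglyMeasurable ?_
      have hae : ∀ᵐ p ∂((volume.restrict (Set.Ioc 0 T)).prod ν), p.1 ∈ Set.Ioc 0 T :=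
        Measure.quasiMeasurePreserving_fst.ae (ae_restrict_mem measurableSet_Ioc)
      filter_upwards [hae] with p hp
      refine (hb _).trans (mul_le_mul_of_nonneg_left ?_ hC)
      have h3 := abs_add_le p.1 p.2
      rw [abs_of_pos hp.1] at h3
      linarith [hp.2]
  have hpt : ∀ z, (∫ s in (0 : ℝ)..T, H (s + z)) =
      (∫ u in (0 : ℝ)..z, H (T + u)) + (∫ u in (0 : ℝ)..T, H u) - ∫ u in (0 : ℝ)..z, H u := by
    intro z
    rw [← primitive_add_sub hm hb, intervalIntegral.integral_comp_add_right, zero_add,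
      ← intervalIntegral.integral_interval_sub_left
        (intervalIntegrable_of_linear_growth hm hb 0 (T + z))
        (intervalIntegrable_of_linear_growth hm hb 0 z)]
    ring
  have hM : ∫ s in (0 : ℝ)..T, H s = ∫ s in (0 : ℝ)..T, ∫ z, H (s + z) ∂ν := by
    refine intervalIntegral.integral_congr fun s hs => hren s ?_
    rw [Set.uIcc_of_le hT] at hs
    exact hs.1
  rw [hswap] at hM
  simp_rw [hpt] at hM
  have hsum : Integrable
      (fun z => (∫ u in (0 : ℝ)..z, H (T + u)) + ∫ u in (0 : ℝ)..T, H u) ν :=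
    (hi T).add (integrable_const _)
  rw [integral_sub hsum hi0,
    integral_add (hi T) (integrable_const _)] at hM
  simp only [integral_const, probReal_univ, one_smul] at hM
  linarith

end LinearGrowth

lemma integral_measureReal_Ici_mul {ν : Measure ℝ} [IsProbabilityMeasure ν] {H : ℝ → ℝ}
    (hm : Measurable H) (hpos : ∀ u, 0 ≤ H u) (hneg : ∀ u, u < 0 → H u = 0)
    (hint : ∀ a b, IntervalIntegrable H volume a b) :
    ∫ s in Set.Ioi (0 : ℝ), (ν (Set.Ici s)).toReal * H s = ∫ z, (∫ u in (0 : ℝ)..z, H u) ∂ν := by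
  have hM : ∀ z : ℝ, ∫ u in (0 : ℝ)..z, H u = ∫ u in (0 : ℝ)..(max z 0), H u := by
    intro z
    rcases le_total 0 z with h | h
    · rw [max_eq_left h]
    · rw [max_eq_right h, intervalIntegral.integral_same, intervalIntegral.integral_symm,
        intervalIntegral.integral_of_le h, integral_Ioc_eq_integral_Ioo,
        setIntegral_eq_zero_of_forall_eq_zero (fun u hu => hneg u hu.2), neg_zero]
  have hmeas : Measurable fun s : ℝ => ν (Set.Ici s) :=
    Antitone.measurable fun a b hab => measure_mono (Set.Ici_subset_Ici.2 hab)
  have hprod : Measurable fun s : ℝ => (ν (Set.Ici s)).toReal * H s := hmeas.ennreal_toReal.mul hm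
  have hcont : Continuous fun z => ∫ u in (0 : ℝ)..z, H u :=
    intervalIntegral.continuous_primitive hint 0
  have hlc := lintegral_comp_eq_lintegral_meas_le_mul ν (f := fun z : ℝ => max z 0) (g := H)
    (Eventually.of_forall fun z => le_max_right _ _) (by fun_prop)
    (fun t _ => hint 0 t) (Eventually.of_forall hpos)
  rw [integral_eq_lintegral_of_nonneg_ae (Eventually.of_forall fun s => by
      have := hpos s
      dsimp
      positivity) hprod.aestronglyMeasurable,
    integral_eq_lintegral_of_nonneg_ae (Eventually.of_forall fun z => by
      dsimp
      rw [hM z]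
      exact intervalIntegral.integral_nonneg (le_max_right _ _) fun u _ => hpos u)
      hcont.aestronglyMeasurable]
  rw [lintegral_congr fun z => congrArg ENNReal.ofReal (hM z), hlc]
  congr 1
  refine setLIntegral_congr_fun measurableSet_Ioi fun s hs => ?_
  have hset : {a : ℝ | s ≤ max a 0} = Set.Ici s := by
    ext a
    simp only [Set.mem_ofPred_eq, Set.mem_Ici, le_max_iff, or_iff_left_iff_imp]
    intro h
    exact absurd hs (not_lt.2 h)
  rw [hset, ENNReal.ofReal_mul ENNReal.toReal_nonneg, ENNReal.ofReal_toReal (measure_ne_top _ _)]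

section Asymptotics

variable {H : ℝ → ℝ} {C : ℝ}

lemma tendsto_shift_div (hlim : Tendsto (fun s => H s / s) atTop (nhds 1)) (u : ℝ) :
    Tendsto (fun R : ℝ => H (R + u) / R) atTop (nhds 1) := by
  have h1 : Tendsto (fun R : ℝ => R + u) atTop atTop := tendsto_atTop_add_const_right _ _ tendsto_id
  have h2 : Tendsto (fun R : ℝ => 1 + u / R) atTop (nhds 1) := by
    simpa using (tendsto_const_nhds (x := (1 : ℝ))).add (tendsto_const_nhds.div_atTop tendsto_id)
  have h3 := (hlim.comp h1).mul h2
  rw [mul_one] at h3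
  refine h3.congr' ?_
  filter_upwards [eventually_gt_atTop 0, h1.eventually_gt_atTop 0] with R hR hRu
  simp only [Function.comp]
  field_simp

lemma abs_integral_shift_div_le (hC : 0 ≤ C) (hb : ∀ u, |H u| ≤ C * (1 + |u|)) {R : ℝ}
    (hR : 1 ≤ R) (y : ℝ) : |(∫ u in (0 : ℝ)..y, H (R + u)) / R| ≤ C * (2 + |y|) * |y| := by
  have hR0 : 0 < R := by linarith
  rw [abs_div, abs_of_pos hR0, div_le_iff₀ hR0]
  refine (abs_integral_shift_le hC hb R y).trans ?_
  rw [abs_of_pos hR0]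
  have : 1 + R + |y| ≤ (2 + |y|) * R := by nlinarith [abs_nonneg y]
  have := mul_le_mul_of_nonneg_left this (mul_nonneg hC (abs_nonneg y))
  linarith

lemma tendsto_integral_shift_div (hm : Measurable H) (hC : 0 ≤ C)
    (hb : ∀ u, |H u| ≤ C * (1 + |u|)) (hlim : Tendsto (fun s => H s / s) atTop (nhds 1)) (y : ℝ) :
    Tendsto (fun R : ℝ => (∫ u in (0 : ℝ)..y, H (R + u)) / R) atTop (nhds y) := by
  have h := intervalIntegral.tendsto_integral_filter_of_dominated_convergence
    (μ := volume) (a := 0) (b := y) (l := atTop) (F := fun (R u : ℝ) => H (R + u) / R)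
    (f := fun _ => 1) (fun _ => C * (2 + |y|))
    (Eventually.of_forall fun R =>
      ((hm.comp (measurable_const_add R)).div_const R).aestronglyMeasurable) ?_ (by simp)
    (Eventually.of_forall fun u _ => tendsto_shift_div hlim u)
  · simpa [intervalIntegral.integral_div] using h
  · filter_upwards [eventually_ge_atTop 1] with R hR
    refine Eventually.of_forall fun u hu => ?_
    have hR0 : 0 < R := by linarith
    have h1 := abs_le_abs_of_mem_uIoc_zero hu
    have h2 := abs_add_le R u
    rw [abs_of_pos hR0] at h2
    rw [Real.norm_eq_abs, abs_div, abs_of_pos hR0, div_le_iff₀ hR0, mul_assoc]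
    refine (hb _).trans (mul_le_mul_of_nonneg_left ?_ hC)
    nlinarith [abs_nonneg y]

lemma continuous_integral_shift (hm : Measurable H) (hb : ∀ u, |H u| ≤ C * (1 + |u|)) :
    Continuous fun p : ℝ × ℝ => ∫ u in (0 : ℝ)..p.2, H (p.1 + u) := by
  simp_rw [← primitive_add_sub hm hb]
  have h := continuous_primitive_of_linear_growth hm hb
  exact (h.comp (by fun_prop)).sub (h.comp continuous_fst)

lemma tendsto_integral_integral_shift_div (hm : Measurable H) (hC : 0 ≤ C)
    (hb : ∀ u, |H u| ≤ C * (1 + |u|)) (hlim : Tendsto (fun s => H s / s) atTop (nhds 1)) (z : ℝ) :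
    Tendsto (fun R : ℝ => ∫ y in (0 : ℝ)..z, (∫ u in (0 : ℝ)..y, H (R + u)) / R) atTop
      (nhds (z ^ 2 / 2)) := by
  have h := intervalIntegral.tendsto_integral_filter_of_dominated_convergence
    (μ := volume) (a := 0) (b := z) (l := atTop)
    (F := fun (R y : ℝ) => (∫ u in (0 : ℝ)..y, H (R + u)) / R)
    (f := fun y => y) (fun y => C * (2 + |y|) * |y|) ?_ ?_
    (Continuous.intervalIntegrable (by fun_prop) _ _)
    (Eventually.of_forall fun y _ => tendsto_integral_shift_div hm hC hb hlim y)
  · simpa using h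
  · refine Eventually.of_forall fun R => Continuous.aestronglyMeasurable ?_
    exact ((continuous_integral_shift hm hb).comp
      (by fun_prop : Continuous fun y : ℝ => (R, y))).div_const R
  · filter_upwards [eventually_ge_atTop 1] with R hR
    exact Eventually.of_forall fun y _ => abs_integral_shift_div_le hC hb hR y

lemma abs_integral_integral_shift_div_le (hC : 0 ≤ C) (hb : ∀ u, |H u| ≤ C * (1 + |u|)) {R : ℝ}
    (hR : 1 ≤ R) (z : ℝ) :
    |∫ y in (0 : ℝ)..z, (∫ u in (0 : ℝ)..y, H (R + u)) / R| ≤ C * (2 + |z|) * |z| * |z| := by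
  have := intervalIntegral.norm_integral_le_of_norm_le_const (a := 0) (b := z)
    (f := fun y => (∫ u in (0 : ℝ)..y, H (R + u)) / R) (C := C * (2 + |z|) * |z|)
    (fun y hy => by
      have h1 := abs_le_abs_of_mem_uIoc_zero hy
      refine (abs_integral_shift_div_le hC hb hR y).trans ?_
      gcongr)
  rwa [Real.norm_eq_abs, sub_zero] at this

lemma continuous_integral_integral_shift_div (hm : Measurable H)
    (hb : ∀ u, |H u| ≤ C * (1 + |u|)) (R : ℝ) :
    Continuous fun z : ℝ => ∫ y in (0 : ℝ)..z, (∫ u in (0 : ℝ)..y, H (R + u)) / R := by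
  refine intervalIntegral.continuous_primitive (fun a b => Continuous.intervalIntegrable ?_ a b) 0
  exact ((continuous_integral_shift hm hb).comp
    (by fun_prop : Continuous fun y : ℝ => (R, y))).div_const R

lemma integrable_integral_integral_shift_div {ν : Measure ℝ}
    (h2 : Integrable (fun x : ℝ => |x| ^ 2) ν) (h3 : Integrable (fun x : ℝ => |x| ^ 3) ν)
    (hm : Measurable H) (hC : 0 ≤ C) (hb : ∀ u, |H u| ≤ C * (1 + |u|)) {R : ℝ} (hR : 1 ≤ R) :
    Integrable (fun z : ℝ => ∫ y in (0 : ℝ)..z, (∫ u in (0 : ℝ)..y, H (R + u)) / R) ν := by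
  refine Integrable.mono' (((h2.const_mul 2).add h3).const_mul C)
    (continuous_integral_integral_shift_div hm hb R).aestronglyMeasurable
    (Eventually.of_forall fun z => ?_)
  refine (abs_integral_integral_shift_div_le hC hb hR z).trans (le_of_eq ?_)
  simp only [Pi.add_apply]
  ring

lemma tendsto_expectation_integral_integral_shift_div {ν : Measure ℝ}
    (h2 : Integrable (fun x : ℝ => |x| ^ 2) ν) (h3 : Integrable (fun x : ℝ => |x| ^ 3) ν)
    (hm : Measurable H) (hC : 0 ≤ C) (hb : ∀ u, |H u| ≤ C * (1 + |u|))
    (hlim : Tendsto (fun s => H s / s) atTop (nhds 1)) :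
    Tendsto (fun R : ℝ => ∫ z, (∫ y in (0 : ℝ)..z, (∫ u in (0 : ℝ)..y, H (R + u)) / R) ∂ν) atTop
      (nhds (∫ z, z ^ 2 / 2 ∂ν)) := by
  refine tendsto_integral_filter_of_dominated_convergence
    (fun z => C * (2 * |z| ^ 2 + |z| ^ 3)) ?_ ?_ (((h2.const_mul 2).add h3).const_mul C)
    (Eventually.of_forall fun z => tendsto_integral_integral_shift_div hm hC hb hlim z)
  · exact Eventually.of_forall fun R =>
      (continuous_integral_integral_shift_div hm hb R).aestronglyMeasurable
  · filter_upwards [eventually_ge_atTop 1] with R hR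
    refine Eventually.of_forall fun z => ?_
    refine (abs_integral_integral_shift_div_le hC hb hR z).trans (le_of_eq ?_)
    ring

/-- The second-order expansion of the twice iterated primitive of `H`. -/
lemma integral_integral_shift_eq (hm : Measurable H) (hb : ∀ u, |H u| ≤ C * (1 + |u|))
    {R : ℝ} (hR : 0 < R) (z : ℝ) :
    (∫ T in (0 : ℝ)..R, ∫ u in (0 : ℝ)..z, H (T + u)) =
      R * (∫ y in (0 : ℝ)..z, (∫ u in (0 : ℝ)..y, H (R + u)) / R) + z * (∫ u in (0 : ℝ)..R, H u)
        - ∫ y in (0 : ℝ)..z, ∫ u in (0 : ℝ)..y, H u := by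
  have hc := continuous_primitive_of_linear_growth hm hb
  have hI : ∀ a b, IntervalIntegrable (fun x => ∫ u in (0 : ℝ)..x, H u) volume a b :=
    fun a b => hc.intervalIntegrable a b
  have hc' : ∀ S : ℝ, Continuous fun x => ∫ u in (0 : ℝ)..(S + x), H u :=
    fun S => hc.comp (by fun_prop)
  have hc'' : Continuous fun x => ∫ u in (0 : ℝ)..(x + z), H u := hc.comp (by fun_prop)
  rw [intervalIntegral.integral_div, mul_div_cancel₀ _ hR.ne']
  simp_rw [← primitive_add_sub hm hb]
  rw [intervalIntegral.integral_sub (hc''.intervalIntegrable _ _) (hI _ _),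
    intervalIntegral.integral_sub ((hc' R).intervalIntegrable _ _) (by simp),
    intervalIntegral.integral_comp_add_right (fun x => ∫ u in (0 : ℝ)..x, H u),
    intervalIntegral.integral_comp_add_left (fun x => ∫ u in (0 : ℝ)..x, H u),
    ← intervalIntegral.integral_interval_sub_left (hI 0 (R + z)) (hI 0 (0 + z)),
    ← intervalIntegral.integral_interval_sub_left (hI 0 (R + z)) (hI 0 (R + 0))]
  simp
  ring

end Asymptotics

/-- `∫_0^∞ ν([s,∞)) G(s) ds = 1/2` for the limiting function `G` of the
renewal-type relation associated to the step distribution `ν`. -/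
theorem stmt9 (ν : Measure ℝ) [IsProbabilityMeasure ν]
    (hmean : ∫ x, x ∂ν = 0) (hvar : ∫ x, x ^ 2 ∂ν = 1)
    (hexp : ∃ c : ℝ, 0 < c ∧ Integrable (fun x => Real.exp (c * |x|)) ν)
    (G : ℝ → ℝ) (hGmeas : Measurable G)
    (hGpos : ∀ s : ℝ, 0 ≤ s → 0 ≤ G s)
    (hGrenewal : ∀ s : ℝ, 0 ≤ s → G s = ∫ z in Set.Ici (-s), G (s + z) ∂ν)
    (hGgrowth : ∃ C : ℝ, ∀ s : ℝ, 0 ≤ s → G s ≤ C * (1 + s))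
    (hGlim : Tendsto (fun s : ℝ => G s / s) atTop (nhds 1)) :
    ∫ s in Set.Ioi (0 : ℝ), (ν (Set.Ici s)).toReal * G s = 1 / 2 := by
  obtain ⟨c, hc, hexp⟩ := hexp
  obtain ⟨C, hGC⟩ := hGgrowth
  have hpow := integrable_abs_pow_of_integrable_exp_mul_abs hc hexp
  have h1 : Integrable (fun x : ℝ => |x|) ν := by simpa using hpow 1
  have h2 := hpow 2
  have h3 := hpow 3
  have hid : Integrable (fun x : ℝ => x) ν := (integrable_norm_iff (by fun_prop)).1 h1
  have hC : 0 ≤ C := by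
    have := (hGpos 0 le_rfl).trans (hGC 0 le_rfl)
    simpa using this
  set H : ℝ → ℝ := (Set.Ici 0).indicator G with hH
  have hHG : ∀ s, 0 ≤ s → H s = G s := fun s hs => Set.indicator_of_mem hs G
  have hneg : ∀ s, s < 0 → H s = 0 := fun s hs => Set.indicator_of_notMem (not_le.2 hs) G
  have hm : Measurable H := hGmeas.indicator measurableSet_Ici
  have hpos : ∀ u, 0 ≤ H u := Set.indicator_nonneg hGpos
  have hb : ∀ u, |H u| ≤ C * (1 + |u|) := by
    intro u
    rw [abs_of_nonneg (hpos u)]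
    rcases le_or_gt 0 u with h | h
    · rw [hHG u h, abs_of_nonneg h]
      exact hGC u h
    · rw [hneg u h]
      positivity
  have hren : ∀ s, 0 ≤ s → H s = ∫ z, H (s + z) ∂ν := by
    intro s hs
    rw [hHG s hs, hGrenewal s hs, ← integral_indicator measurableSet_Ici]
    congr 1
    ext z
    simp only [hH, Set.indicator_apply, Set.mem_Ici]
    congr 1
    exact propext neg_le_iff_add_nonneg'
  have hlim : Tendsto (fun s => H s / s) atTop (nhds 1) := by
    refine hGlim.congr' ?_
    filter_upwards [eventually_ge_atTop 0] with s hs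
    rw [hHG s hs]
  have hKH : ∫ s in Set.Ioi (0 : ℝ), (ν (Set.Ici s)).toReal * G s
      = ∫ s in Set.Ioi (0 : ℝ), (ν (Set.Ici s)).toReal * H s :=
    setIntegral_congr_fun measurableSet_Ioi fun s hs => by
      rw [hHG s (le_of_lt hs)]
  rw [hKH, integral_measureReal_Ici_mul hm hpos hneg (intervalIntegrable_of_linear_growth hm hb)]
  set K := ∫ z, (∫ u in (0 : ℝ)..z, H u) ∂ν
  set N : ℝ → ℝ := fun z => ∫ y in (0 : ℝ)..z, ∫ u in (0 : ℝ)..y, H u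
  have hNint : Integrable N ν := by
    have hNc : Continuous N := intervalIntegral.continuous_primitive
      (fun a b => (continuous_primitive_of_linear_growth hm hb).intervalIntegrable a b) 0
    refine Integrable.mono' ((h2.add h3).const_mul C) hNc.aestronglyMeasurable
      (Eventually.of_forall fun z => ?_)
    have := intervalIntegral.norm_integral_le_of_norm_le_const (a := 0) (b := z)
      (f := fun y => ∫ u in (0 : ℝ)..y, H u) (C := C * (1 + |z|) * |z|)
      (fun y hy => by
        have h1 := abs_le_abs_of_mem_uIoc_zero hy
        have h2 := abs_integral_shift_le hC hb 0 y
        simp only [zero_add, abs_zero, add_zero] at h2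
        refine h2.trans ?_
        gcongr)
    refine this.trans (le_of_eq ?_)
    simp only [sub_zero, Pi.add_apply]
    ring
  have hident : ∀ R : ℝ, 1 ≤ R →
      K = (∫ z, (∫ y in (0 : ℝ)..z, (∫ u in (0 : ℝ)..y, H (R + u)) / R) ∂ν)
        - (∫ z, N z ∂ν) / R := by
    intro R hR
    have hR0 : 0 < R := by linarith
    have hconst : K * R = ∫ T in (0 : ℝ)..R, ∫ z, (∫ u in (0 : ℝ)..z, H (T + u)) ∂ν := by
      have : ∫ T in (0 : ℝ)..R, ∫ z, (∫ u in (0 : ℝ)..z, H (T + u)) ∂ν = ∫ T in (0 : ℝ)..R, K := by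
        refine intervalIntegral.integral_congr fun T hT => ?_
        rw [Set.uIcc_of_le hR0.le] at hT
        exact (integral_primitive_eq_integral_increment h1 h2 hm hC hb hren hT.1).symm
      rw [this]
      simp [mul_comm]
    have hswap : ∫ T in (0 : ℝ)..R, ∫ z, (∫ u in (0 : ℝ)..z, H (T + u)) ∂ν
        = ∫ z, (∫ T in (0 : ℝ)..R, ∫ u in (0 : ℝ)..z, H (T + u)) ∂ν := by
      rw [intervalIntegral.integral_of_le hR0.le, integral_integral_swap]
      · simp_rw [intervalIntegral.integral_of_le hR0.le]
      · have hb' : Integrable (fun z : ℝ => C * ((1 + R) * |z| + |z| ^ 2)) ν :=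
          ((h1.const_mul _).add h2).const_mul C
        refine Integrable.mono' (hb'.comp_snd (volume.restrict (Set.Ioc 0 R)))
          (continuous_integral_shift hm hb).aestronglyMeasurable ?_
        have hae : ∀ᵐ p ∂((volume.restrict (Set.Ioc 0 R)).prod ν), p.1 ∈ Set.Ioc 0 R :=
          Measure.quasiMeasurePreserving_fst.ae (ae_restrict_mem measurableSet_Ioc)
        filter_upwards [hae] with p hp
        refine (abs_integral_shift_le hC hb p.1 p.2).trans ?_
        rw [abs_of_pos hp.1]
        have : C * (1 + p.1 + |p.2|) * |p.2| ≤ C * (1 + R + |p.2|) * |p.2| := by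
          gcongr
          exact hp.2
        linarith
    have hg := integrable_integral_integral_shift_div h2 h3 hm hC hb hR
    rw [hswap] at hconst
    simp_rw [integral_integral_shift_eq hm hb hR0] at hconst
    have hsum : Integrable (fun z => R * (∫ y in (0 : ℝ)..z, (∫ u in (0 : ℝ)..y, H (R + u)) / R)
        + z * ∫ u in (0 : ℝ)..R, H u) ν := (hg.const_mul R).add (hid.mul_const _)
    rw [integral_sub hsum hNint,
      integral_add (hg.const_mul R) (hid.mul_const _), integral_const_mul, integral_mul_const,
      hmean, zero_mul, add_zero] at hconst
    field_simp
    linarith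
  have ht := (tendsto_expectation_integral_integral_shift_div h2 h3 hm hC hb hlim).sub
    ((tendsto_const_nhds (x := ∫ z, N z ∂ν)).div_atTop tendsto_id)
  rw [integral_div, hvar, sub_zero] at ht
  refine tendsto_nhds_unique (tendsto_const_nhds.congr' ?_) ht
  filter_upwards [eventually_ge_atTop 1] with R hR using hident R hR
end

section
/- For every K > 0 one has the identity ∫_0^K G(s) ds = ∫_0^∞ G(z) ν([z−K, z]) dz. -/
open MeasureTheory Filter

/-- Tonelli's theorem for the convolution of a function with a measure, over an interval. -/
theorem setLIntegral_lintegral_add_eq (ν : Measure ℝ) [SFinite ν] {g : ℝ → ENNReal}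
    (hg : Measurable g) (K : ℝ) :
    ∫⁻ s in Set.Icc 0 K, ∫⁻ x, g (s + x) ∂ν = ∫⁻ z, g z * ν (Set.Icc (z - K) z) := by
  set i : ℝ → ENNReal := (Set.Icc (0 : ℝ) K).indicator 1 with hi
  have him : Measurable i := measurable_one.indicator measurableSet_Icc
  calc ∫⁻ s in Set.Icc 0 K, ∫⁻ x, g (s + x) ∂ν
      = ∫⁻ s, ∫⁻ x, i s * g (s + x) ∂ν := by
        rw [← lintegral_indicator measurableSet_Icc]
        refine lintegral_congr fun s => ?_
        rw [lintegral_const_mul _ (by fun_prop)]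
        by_cases hs : s ∈ Set.Icc 0 K <;> simp [hi, hs]
    _ = ∫⁻ x, (∫⁻ s, i s * g (s + x)) ∂ν := by
        refine lintegral_lintegral_swap (Measurable.aemeasurable ?_)
        unfold Function.uncurry
        fun_prop
    _ = ∫⁻ x, (∫⁻ z, i (z - x) * g z) ∂ν := by
        refine lintegral_congr fun x => ?_
        simpa using lintegral_add_right_eq_self (μ := volume) (fun z => i (z - x) * g z) x
    _ = ∫⁻ z, ∫⁻ x, i (z - x) * g z ∂ν := by
        refine lintegral_lintegral_swap (Measurable.aemeasurable ?_)
        unfold Function.uncurry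
        fun_prop
    _ = ∫⁻ z, g z * ν (Set.Icc (z - K) z) := by
        refine lintegral_congr fun z => ?_
        rw [lintegral_mul_const _ (by fun_prop), mul_comm,
          ← lintegral_indicator_one measurableSet_Icc]
        congr 2 with x
        have h : z - x ∈ Set.Icc 0 K ↔ x ∈ Set.Icc (z - K) z := by
          simp only [Set.mem_Icc]
          constructor <;> rintro ⟨h₁, h₂⟩ <;> constructor <;> linarith
        by_cases hx : x ∈ Set.Icc (z - K) z
        · simp only [hi, Set.indicator_of_mem hx, Set.indicator_of_mem (h.2 hx), Pi.one_apply]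
        · simp only [hi, Set.indicator_of_notMem hx, Set.indicator_of_notMem (mt h.1 hx)]

/-- A measure with a finite exponential moment has a finite first absolute moment. -/
theorem integrable_abs_of_integrable_exp_mul_abs {ν : Measure ℝ} {c : ℝ} (hc : 0 < c)
    (h : Integrable (fun x => Real.exp (c * |x|)) ν) : Integrable (fun x : ℝ => |x|) ν := by
  refine (h.const_mul c⁻¹).mono' (by fun_prop) (ae_of_all _ fun x => ?_)
  rw [Real.norm_eq_abs, abs_abs, inv_mul_eq_div, le_div_iff₀ hc]
  linarith [Real.add_one_le_exp (c * |x|)]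

/-- For every `K > 0`, `∫_0^K G(s) ds = ∫_0^∞ G(z) ν([z-K, z]) dz`. -/
theorem stmt10 (ν : Measure ℝ) [IsProbabilityMeasure ν]
    (hmean : ∫ x, x ∂ν = 0) (hvar : ∫ x, x ^ 2 ∂ν = 1)
    (hexp : ∃ c : ℝ, 0 < c ∧ Integrable (fun x => Real.exp (c * |x|)) ν)
    (G : ℝ → ℝ) (hGmeas : Measurable G)
    (hGpos : ∀ s : ℝ, 0 ≤ s → 0 ≤ G s)
    (hGrenewal : ∀ s : ℝ, 0 ≤ s → G s = ∫ z in Set.Ici (-s), G (s + z) ∂ν)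
    (hGgrowth : ∃ C : ℝ, ∀ s : ℝ, 0 ≤ s → G s ≤ C * (1 + s))
    (hGlim : Tendsto (fun s : ℝ => G s / s) atTop (nhds 1)) :
    ∀ K : ℝ, 0 < K →
      ∫ s in Set.Ioc (0 : ℝ) K, G s
        = ∫ z in Set.Ioi (0 : ℝ), G z * (ν (Set.Icc (z - K) z)).toReal := by
  intro K _
  obtain ⟨c, hc, hce⟩ := hexp
  obtain ⟨C, hC⟩ := hGgrowth
  have habs := integrable_abs_of_integrable_exp_mul_abs hc hce
  set g : ℝ → ENNReal := (Set.Ici (0 : ℝ)).indicator fun z => ENNReal.ofReal (G z) with hg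
  have hgm : Measurable g := hGmeas.ennreal_ofReal.indicator measurableSet_Ici
  have hrenewal : ∀ s, 0 ≤ s → ENNReal.ofReal (G s) = ∫⁻ x, g (s + x) ∂ν := by
    intro s hs
    have hnonneg : ∀ᵐ z ∂ν.restrict (Set.Ici (-s)), 0 ≤ G (s + z) := by
      filter_upwards [ae_restrict_mem measurableSet_Ici] with z hz
      exact hGpos _ (by linarith [Set.mem_Ici.1 hz])
    have hint : Integrable (fun z => G (s + z)) (ν.restrict (Set.Ici (-s))) := by
      refine Integrable.mono' (g := fun z => |C| * (1 + s + |z|)) ?_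
        (hGmeas.comp (measurable_const_add s)).aestronglyMeasurable ?_
      · exact (((integrable_const (1 + s)).add habs).const_mul |C|).restrict
      · filter_upwards [hnonneg, ae_restrict_mem measurableSet_Ici] with z hz hzs
        have hsz : 0 ≤ s + z := by linarith [Set.mem_Ici.1 hzs]
        rw [Real.norm_of_nonneg hz]
        calc G (s + z) ≤ C * (1 + (s + z)) := hC _ hsz
          _ ≤ |C| * (1 + (s + z)) := by gcongr; exact le_abs_self C
          _ ≤ |C| * (1 + s + |z|) := by gcongr ?_ * ?_; linarith [le_abs_self z]
    rw [hGrenewal s hs, ofReal_integral_eq_lintegral_ofReal hint hnonneg,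
      ← lintegral_indicator measurableSet_Ici]
    refine lintegral_congr fun z => ?_
    simp only [hg, Set.indicator_apply, Set.mem_Ici, neg_le_iff_add_nonneg']
  rw [← integral_Icc_eq_integral_Ioc, ← integral_Ici_eq_integral_Ioi]
  have hνm : Measurable fun z => ν (Set.Icc (z - K) z) := by
    have hS : MeasurableSet {p : ℝ × ℝ | p.1 - K ≤ p.2 ∧ p.2 ≤ p.1} := by
      measurability
    exact measurable_measure_prodMk_left hS
  rw [integral_eq_lintegral_of_nonneg_ae, integral_eq_lintegral_of_nonneg_ae]
  · congr 1
    rw [setLIntegral_congr_fun measurableSet_Icc fun s hs => hrenewal s hs.1,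
      setLIntegral_lintegral_add_eq ν hgm, ← lintegral_indicator measurableSet_Ici]
    refine lintegral_congr fun z => ?_
    by_cases hz : z ∈ Set.Ici (0 : ℝ)
    · simp only [hg, Set.indicator_of_mem hz]
      rw [ENNReal.ofReal_mul (hGpos z hz), ENNReal.ofReal_toReal (measure_ne_top _ _)]
    · simp only [hg, Set.indicator_of_notMem hz, zero_mul]
  · filter_upwards [ae_restrict_mem measurableSet_Ici] with z hz
    exact mul_nonneg (hGpos z hz) ENNReal.toReal_nonneg
  · exact (hGmeas.mul hνm.ennreal_toReal).aestronglyMeasurable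
  · filter_upwards [ae_restrict_mem measurableSet_Icc] with s hs
    exact hGpos s hs.1
  · exact hGmeas.aestronglyMeasurable
end

section
/- For every t ∈ [0, T], every h ∈ (0, 1], and every λ > 0, one has ∫_t^{t+h} f(s) ds ≤ (h/λ) ∫_0^{T+1} e^{λ f(s)} ds + (h(1+h)/λ) · log(1 + 1/h). -/
open MeasureTheory

/-- The tangent-line bound for `exp` at the point `-log h`. -/
theorem le_mul_exp_sub_log {h : ℝ} (hh : 0 < h) (x : ℝ) :
    x ≤ h * Real.exp x - Real.log h := by
  have key := Real.add_one_le_exp (x + Real.log h)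
  rw [Real.exp_add, Real.exp_log hh] at key
  linarith

theorem neg_log_le_mul_log_one_add_one_div {h : ℝ} (hh : 0 < h) :
    -Real.log h ≤ (1 + h) * Real.log (1 + 1 / h) := by
  have hinv : 0 < 1 / h := by positivity
  have hle : Real.log (1 / h) ≤ Real.log (1 + 1 / h) := Real.log_le_log hinv (by linarith)
  have hnn : 0 ≤ Real.log (1 + 1 / h) := Real.log_nonneg (by linarith)
  rw [one_div, Real.log_inv, ← one_div] at hle
  linarith [mul_nonneg hh.le hnn]

/-- The quantitative workload estimate: for `t ∈ [0,T]`, `h ∈ (0,1]` and `λ > 0`,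
`∫_t^{t+h} f ≤ (h/λ) ∫_0^{T+1} e^{λ f} + (h(1+h)/λ) log(1 + 1/h)`. -/
theorem stmt12 (T : ℝ) (hT : 0 < T) (f : ℝ → ℝ) (hfmeas : Measurable f)
    (hfpos : ∀ s ∈ Set.Icc (0 : ℝ) (T + 1), 0 ≤ f s)
    (lam : ℝ) (hlam : 0 < lam)
    (hint : IntegrableOn (fun s => Real.exp (lam * f s)) (Set.Icc (0 : ℝ) (T + 1))) :
    ∀ t ∈ Set.Icc (0 : ℝ) T, ∀ h : ℝ, 0 < h → h ≤ 1 →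
      ∫ s in Set.Ioc t (t + h), f s
        ≤ (h / lam) * (∫ s in Set.Icc (0 : ℝ) (T + 1), Real.exp (lam * f s))
          + (h * (1 + h) / lam) * Real.log (1 + 1 / h) := by
  intro t ht h hh hh1
  have hsub : Set.Ioc t (t + h) ⊆ Set.Icc 0 (T + 1) := fun s hs =>
    ⟨ht.1.trans hs.1.le, by linarith [hs.2, ht.2]⟩
  set L := Real.log (1 + 1 / h)
  have hpt (s : ℝ) : f s ≤ h / lam * Real.exp (lam * f s) + (1 + h) * L / lam := by
    have h1 := le_mul_exp_sub_log hh (lam * f s)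
    have h2 := neg_log_le_mul_log_one_add_one_div hh
    rw [div_mul_eq_mul_div, ← add_div, le_div_iff₀ hlam]
    linarith
  have hexp := (hint.mono_set hsub).const_mul (h / lam)
  have hconst : IntegrableOn (fun _ : ℝ => (1 + h) * L / lam) (Set.Ioc t (t + h)) :=
    integrableOn_const measure_Ioc_lt_top.ne
  calc ∫ s in Set.Ioc t (t + h), f s
      ≤ ∫ s in Set.Ioc t (t + h), (h / lam * Real.exp (lam * f s) + (1 + h) * L / lam) :=
        integral_mono_of_nonneg
          ((ae_restrict_mem measurableSet_Ioc).mono fun s hs => hfpos s (hsub hs))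
          (hexp.add hconst) (Filter.Eventually.of_forall hpt)
    _ = h / lam * (∫ s in Set.Ioc t (t + h), Real.exp (lam * f s)) + h * (1 + h) / lam * L := by
        rw [integral_add hexp hconst, integral_const_mul, setIntegral_const,
          Real.volume_real_Ioc_of_le (by linarith), smul_eq_mul]
        ring
    _ ≤ _ := by
        refine add_le_add_left (mul_le_mul_of_nonneg_left ?_ (by positivity)) _
        exact setIntegral_mono_set hint
          (Filter.Eventually.of_forall fun s => (Real.exp_pos _).le) hsub.eventuallyLE
end

section
/- There exists a finite constant C such that for every t ∈ [0, T], limsup_{h→0⁺} ( F(t+h) − F(t) ) / ( h · log(1/h) ) ≤ C; in other words, sup_{t ≤ T} limsup_{h→0⁺} |F(t+h) − F(t)| / (h |log h|) < ∞. -/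
open MeasureTheory Filter

/-- A function with an integrable exponential moment is integrable on sets where it is
nonnegative. -/
theorem integrableOn_of_integrableOn_exp_mul {f : ℝ → ℝ} {S : Set ℝ} {lam : ℝ}
    (hS : MeasurableSet S) (hf : Measurable f) (hpos : ∀ s ∈ S, 0 ≤ f s) (hlam : 0 < lam)
    (hint : IntegrableOn (fun s => Real.exp (lam * f s)) S) : IntegrableOn f S := by
  refine Integrable.mono' (hint.const_mul lam⁻¹) hf.aestronglyMeasurable ?_
  filter_upwards [ae_restrict_mem hS] with s hs
  rw [Real.norm_of_nonneg (hpos s hs), inv_mul_eq_div, le_div_iff₀ hlam]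
  linarith [Real.add_one_le_exp (lam * f s)]

/-- Integrating the tangent-line bound `lam * f ≤ -log h + h * exp (lam * f)` over an interval
of length `h`. -/
theorem mul_setIntegral_Ioc_le {f : ℝ → ℝ} {lam t h : ℝ} (hh : 0 < h)
    (hf : IntegrableOn f (Set.Ioc t (t + h)))
    (hint : IntegrableOn (fun s => Real.exp (lam * f s)) (Set.Ioc t (t + h))) :
    lam * ∫ s in Set.Ioc t (t + h), f s ≤
      h * (-Real.log h) + h * ∫ s in Set.Ioc t (t + h), Real.exp (lam * f s) := by
  have hconst : IntegrableOn (fun _ : ℝ => -Real.log h) (Set.Ioc t (t + h)) :=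
    integrableOn_const (by simp)
  calc lam * ∫ s in Set.Ioc t (t + h), f s
      = ∫ s in Set.Ioc t (t + h), lam * f s := (integral_const_mul _ _).symm
    _ ≤ ∫ s in Set.Ioc t (t + h), (-Real.log h + h * Real.exp (lam * f s)) := by
        refine integral_mono (hf.const_mul lam) (hconst.add (hint.const_mul h)) fun s => ?_
        have key := Real.add_one_le_exp (lam * f s + Real.log h)
        rw [Real.exp_add, Real.exp_log hh] at key
        dsimp only
        linarith
    _ = h * (-Real.log h) + h * ∫ s in Set.Ioc t (t + h), Real.exp (lam * f s) := by
        rw [integral_add hconst (hint.const_mul h), integral_const_mul, setIntegral_const]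
        simp [hh.le]

/-- Modulus of continuity of the workload: `F(t) = ∫_0^t f(s) ds` satisfies
`sup_{t ≤ T} limsup_{h → 0⁺} |F(t+h) - F(t)| / (h |log h|) < ∞`. -/
theorem stmt13 (T : ℝ) (hT : 0 < T) (f : ℝ → ℝ) (hfmeas : Measurable f)
    (hfpos : ∀ s ∈ Set.Icc (0 : ℝ) (T + 1), 0 ≤ f s)
    (hint : ∃ lam : ℝ, 0 < lam ∧
      IntegrableOn (fun s => Real.exp (lam * f s)) (Set.Icc (0 : ℝ) (T + 1)))
    (F : ℝ → ℝ) (hF : ∀ t ∈ Set.Icc (0 : ℝ) (T + 1), F t = ∫ s in Set.Ioc (0 : ℝ) t, f s) :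
    ∃ C : ℝ, ∀ t ∈ Set.Icc (0 : ℝ) T,
      Filter.limsup (fun h : ℝ => ((|F (t + h) - F t| / (h * |Real.log h|) : ℝ) : EReal))
        (nhdsWithin 0 (Set.Ioi 0)) ≤ (C : EReal) := by
  obtain ⟨lam, hlam, hexp⟩ := hint
  have hfint := integrableOn_of_integrableOn_exp_mul measurableSet_Icc hfmeas hfpos hlam hexp
  set K := ∫ s in Set.Icc (0 : ℝ) (T + 1), Real.exp (lam * f s)
  have hK0 : 0 ≤ K := integral_nonneg fun s => (Real.exp_pos _).le
  refine ⟨(1 + K) / lam, fun t ht => limsup_le_of_le (by isBoundedDefault) ?_⟩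
  filter_upwards [Ioo_mem_nhdsGT (Real.exp_pos (-1))] with h hh
  obtain ⟨hh0, hh1⟩ := hh
  have hlog : Real.log h < -1 := (Real.log_lt_iff_lt_exp hh0).2 hh1
  have hle : h ≤ 1 := hh1.le.trans (Real.exp_le_one_iff.2 (by norm_num))
  have hsub : Set.Ioc t (t + h) ⊆ Set.Icc 0 (T + 1) := fun s hs =>
    ⟨ht.1.trans hs.1.le, hs.2.trans (by linarith [ht.2])⟩
  have hsub' : Set.Ioc 0 t ⊆ Set.Icc 0 (T + 1) := fun s hs =>
    ⟨hs.1.le, hs.2.trans (by linarith [ht.2])⟩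
  have hdiff : F (t + h) - F t = ∫ s in Set.Ioc t (t + h), f s := by
    rw [hF _ ⟨by linarith [ht.1], by linarith [ht.2]⟩, hF t ⟨ht.1, by linarith [ht.2]⟩,
      ← Set.Ioc_union_Ioc_eq_Ioc ht.1 (by linarith : t ≤ t + h),
      setIntegral_union (Set.Ioc_disjoint_Ioc_of_le le_rfl) measurableSet_Ioc
        (hfint.mono_set hsub') (hfint.mono_set hsub)]
    ring
  have hnonneg : 0 ≤ ∫ s in Set.Ioc t (t + h), f s :=
    setIntegral_nonneg measurableSet_Ioc fun s hs => hfpos s (hsub hs)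
  have hmono : ∫ s in Set.Ioc t (t + h), Real.exp (lam * f s) ≤ K :=
    setIntegral_mono_set hexp (ae_of_all _ fun s => (Real.exp_pos _).le) hsub.eventuallyLE
  have hbound := mul_setIntegral_Ioc_le hh0 (hfint.mono_set hsub) (hexp.mono_set hsub)
  rw [EReal.coe_le_coe_iff, hdiff, abs_of_nonneg hnonneg, abs_of_neg (by linarith),
    div_le_div_iff₀ (mul_pos hh0 (by linarith)) hlam]
  have hKh := mul_le_mul_of_nonneg_left hmono hh0.le
  have hKlog : h * K ≤ h * (K * -Real.log h) :=
    mul_le_mul_of_nonneg_left (le_mul_of_one_le_right hK0 (by linarith)) hh0.le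
  linarith
end

section
/- Suppose that ∫_Y D_π dπ ≥ δ for some δ > 0, that |∫_Y f dμ − ∫_Y f dπ| ≤ ε₁ for every f : Y → ℝ that is 1-Lipschitz with respect to d, and that sup_{x∈Y} |D_π(x) − D_μ(x)| ≤ ε₂. Assume moreover that ∫_Y D_μ dμ > 0, and define the probability measures μ̃(A) = (∫_A D_μ dμ)/(∫_Y D_μ dμ) and π̃(A) = (∫_A D_π dπ)/(∫_Y D_π dπ). Then for every ρ ∈ (0,1] and every f : Y → ℝ that is 1-Lipschitz with respect to d, one has |∫_Y f dμ̃ − ∫_Y f dπ̃| ≤ (1/δ) ( 3ε₁/ρ + ε₂ + 2 π(Ā_ρ) ). -/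
open MeasureTheory

/-- Functions that are `K`-Lipschitz have integrals within `K * ε` as soon as this holds for
`K = 1`. -/
theorem abs_integral_sub_le_mul_of_lipschitz {Y : Type*} [PseudoMetricSpace Y] [MeasurableSpace Y]
    {μ π : Measure Y} {ε : ℝ}
    (h : ∀ f : Y → ℝ, LipschitzWith 1 f → |(∫ x, f x ∂μ) - (∫ x, f x ∂π)| ≤ ε)
    {K : ℝ} (hK : 0 < K) {u : Y → ℝ} (hu : ∀ x y, |u x - u y| ≤ K * dist x y) :
    |(∫ x, u x ∂μ) - (∫ x, u x ∂π)| ≤ K * ε := by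
  have key := h (fun x => K⁻¹ * u x) (LipschitzWith.of_dist_le_mul fun x y => by
    rw [Real.dist_eq, ← mul_sub, abs_mul, abs_of_pos (inv_pos.2 hK), NNReal.coe_one, one_mul,
      inv_mul_le_iff₀ hK]
    exact hu x y)
  rwa [integral_const_mul, integral_const_mul, ← mul_sub, abs_mul, abs_of_pos (inv_pos.2 hK),
    inv_mul_le_iff₀ hK] at key

/-- A `[0,1]`-valued function agrees, off the set where it fails to be `1/ρ`-Lipschitz from above,
with a globally `1/ρ`-Lipschitz `[0,1]`-valued function. -/
theorem exists_lipschitz_eq_off_increase {Y : Type*} [PseudoMetricSpace Y] {D : Y → ℝ}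
    (hD : ∀ x, D x ∈ Set.Icc (0 : ℝ) 1) {ρ : ℝ} (hρ : 0 < ρ) :
    ∃ g : Y → ℝ, (∀ x y, |g x - g y| ≤ 1 / ρ * dist x y) ∧ (∀ x, g x ∈ Set.Icc (0 : ℝ) 1) ∧
      ∀ x, x ∉ {z : Y | ∃ y : Y, D z + dist z y / ρ < D y} → g x = D x := by
  have hlip : LipschitzOnWith (Real.toNNReal (1 / ρ)) D
      {z : Y | ∃ y : Y, D z + dist z y / ρ < D y}ᶜ := by
    refine LipschitzOnWith.of_dist_le_mul fun x hx y hy => ?_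
    simp only [Set.mem_compl_iff, Set.mem_ofPred_eq, not_exists, not_lt] at hx hy
    have h1 := hx y
    have h2 := hy x
    rw [dist_comm] at h2
    rw [Real.coe_toNNReal _ (by positivity), Real.dist_eq, one_div_mul_eq_div, abs_le]
    constructor <;> linarith
  obtain ⟨g, hg, hgD⟩ := hlip.extend_real
  refine ⟨fun x => max 0 (min 1 (g x)), fun x y => ?_, fun x => ⟨le_max_left _ _, ?_⟩,
    fun x hx => ?_⟩
  · have h := ((hg.const_min 1).const_max 0).dist_le_mul x y
    rwa [Real.coe_toNNReal _ (by positivity), Real.dist_eq] at h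
  · exact max_le zero_le_one (min_le_left _ _)
  · have h : D x = g x := hgD hx
    simp only [← h, min_eq_right (hD x).2, max_eq_right (hD x).1]

/-- A `1/ρ`-Lipschitz cutoff between a set and its closed `ρ`-thickening. -/
theorem exists_lipschitz_cutoff {Y : Type*} [PseudoMetricSpace Y] (A : Set Y) {ρ : ℝ}
    (hρ : 0 < ρ) :
    ∃ h : Y → ℝ, (∀ x y, |h x - h y| ≤ 1 / ρ * dist x y) ∧ (∀ x, h x ∈ Set.Icc (0 : ℝ) 1) ∧
      (∀ x ∈ A, h x = 1) ∧ ∀ x, x ∉ Metric.cthickening ρ A → h x = 0 := by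
  rcases A.eq_empty_or_nonempty with rfl | hA
  · exact ⟨fun _ => 0, fun x y => by simpa using by positivity, by simp, by simp, by simp⟩
  refine ⟨fun x => max (1 - Metric.infDist x A / ρ) 0, fun x y => ?_,
    fun x => ⟨le_max_right _ _, ?_⟩,
    fun x hx => ?_, fun x hx => ?_⟩
  · have h1 := (Metric.lipschitz_infDist_pt A).dist_le_mul x y
    rw [NNReal.coe_one, one_mul, Real.dist_eq] at h1
    calc _ ≤ |(1 - Metric.infDist x A / ρ) - (1 - Metric.infDist y A / ρ)| :=
          abs_max_sub_max_le_abs _ _ _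
      _ = |Metric.infDist x A - Metric.infDist y A| / ρ := by
          rw [← abs_of_pos hρ, ← abs_div, abs_of_pos hρ, ← abs_neg]; congr 1; ring
      _ ≤ dist x y / ρ := by gcongr
      _ = _ := by ring
  · have : 0 ≤ Metric.infDist x A / ρ := div_nonneg Metric.infDist_nonneg hρ.le
    exact max_le (by linarith) zero_le_one
  · simp [Metric.infDist_zero_of_mem hx]
  · have h1 : ρ < Metric.infDist x A := by
      by_contra! hle
      exact hx ((ENNReal.le_ofReal_iff_toReal_le (Metric.infEDist_ne_top hA) hρ.le).2 hle)
    have : 1 < Metric.infDist x A / ρ := (one_lt_div hρ).2 h1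
    exact max_eq_right (by linarith)

/-- A measurable function bounded in absolute value is integrable for a finite measure. -/
theorem integrable_of_abs_le {Y : Type*} [MeasurableSpace Y] {ν : Measure Y} [IsFiniteMeasure ν]
    {u : Y → ℝ} (hu : Measurable u) {C : ℝ} (hC : ∀ x, |u x| ≤ C) : Integrable u ν :=
  Integrable.of_bound hu.aestronglyMeasurable C (Filter.Eventually.of_forall hC)

theorem abs_mul_le_of_abs_le_one {a b c : ℝ} (ha : |a| ≤ 1) (hb : |b| ≤ c) : |a * b| ≤ c := by
  rw [abs_mul]
  exact (mul_le_of_le_one_left (abs_nonneg b) ha).trans hb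

/-- Integrals of a bounded Lipschitz function times a `[0,1]`-valued function, against two measures
that are close on Lipschitz functions. -/
theorem abs_integral_mul_sub_le {Y : Type*} [PseudoMetricSpace Y] [MeasurableSpace Y] [BorelSpace Y]
    {μ π : Measure Y} [IsProbabilityMeasure μ] [IsProbabilityMeasure π] {D : Y → ℝ}
    (hDm : Measurable D) (hD : ∀ x, D x ∈ Set.Icc (0 : ℝ) 1) {ε : ℝ}
    (hε : ∀ f : Y → ℝ, LipschitzWith 1 f → |(∫ x, f x ∂μ) - (∫ x, f x ∂π)| ≤ ε)
    {ρ : ℝ} (hρ0 : 0 < ρ) (hρ1 : ρ ≤ 1) {f : Y → ℝ} (hf : LipschitzWith 1 f)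
    (hf1 : ∀ x, |f x| ≤ 1) :
    |(∫ x, f x * D x ∂μ) - (∫ x, f x * D x ∂π)| ≤ 3 * ε / ρ
      + 2 * π.real (Metric.cthickening ρ {z : Y | ∃ y : Y, D z + dist z y / ρ < D y}) := by
  set A := {z : Y | ∃ y : Y, D z + dist z y / ρ < D y}
  obtain ⟨g, hgl, hg01, hgD⟩ := exists_lipschitz_eq_off_increase hD hρ0
  obtain ⟨h, hhl, hh01, hhA, hh0⟩ := exists_lipschitz_cutoff A hρ0
  have hmeas : ∀ u : Y → ℝ, (∀ x y, |u x - u y| ≤ 1 / ρ * dist x y) → Measurable u := by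
    intro u hu
    refine (LipschitzWith.of_dist_le_mul (K := Real.toNNReal (1 / ρ))
      fun x y => ?_).continuous.measurable
    rw [Real.coe_toNNReal _ (by positivity)]
    exact hu x y
  have hfm := hf.continuous.measurable
  have hgm := hmeas g hgl
  have hhm := hmeas h hhl
  have habs : ∀ u : Y → ℝ, (∀ x, u x ∈ Set.Icc (0 : ℝ) 1) → ∀ x, |u x| ≤ 1 := fun u hu x => by
    rw [abs_of_nonneg (hu x).1]; exact (hu x).2
  have hfg : |(∫ x, f x * g x ∂μ) - (∫ x, f x * g x ∂π)| ≤ 2 / ρ * ε := by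
    refine abs_integral_sub_le_mul_of_lipschitz hε (by positivity) fun x y => ?_
    have h1 : |f x - f y| ≤ dist x y := by simpa [Real.dist_eq] using hf.dist_le_mul x y
    have h2 : 1 ≤ 1 / ρ := (one_le_div hρ0).2 hρ1
    calc |f x * g x - f y * g y| = |f x * (g x - g y) + g y * (f x - f y)| := by congr 1; ring
      _ ≤ |f x * (g x - g y)| + |g y * (f x - f y)| := abs_add_le _ _
      _ ≤ 1 / ρ * dist x y + dist x y := add_le_add
          (abs_mul_le_of_abs_le_one (hf1 x) (hgl x y))
          (abs_mul_le_of_abs_le_one (habs g hg01 y) h1)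
      _ ≤ 1 / ρ * dist x y + 1 / ρ * dist x y := by
          gcongr; exact le_mul_of_one_le_left dist_nonneg h2
      _ = 2 / ρ * dist x y := by ring
  have hdiff : ∀ (ν : Measure Y) [IsProbabilityMeasure ν],
      |(∫ x, f x * D x ∂ν) - (∫ x, f x * g x ∂ν)| ≤ ∫ x, h x ∂ν := by
    intro ν _
    have hi : ∀ u : Y → ℝ, Measurable u → (∀ x, u x ∈ Set.Icc (0 : ℝ) 1) →
        Integrable (fun x => f x * u x) ν := fun u hum hu =>
      integrable_of_abs_le (hfm.mul hum) fun x => abs_mul_le_of_abs_le_one (hf1 x) (habs u hu x)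
    rw [← integral_sub (hi D hDm hD) (hi g hgm hg01)]
    refine abs_integral_le_integral_abs.trans (integral_mono_of_nonneg
      (Filter.Eventually.of_forall fun x => abs_nonneg _)
      (integrable_of_abs_le hhm (habs h hh01)) (Filter.Eventually.of_forall fun x => ?_))
    simp only [← mul_sub]
    refine abs_mul_le_of_abs_le_one (hf1 x) ?_
    by_cases hx : x ∈ A
    · rw [hhA x hx, abs_le]
      constructor <;> linarith [(hD x).1, (hD x).2, (hg01 x).1, (hg01 x).2]
    · simpa [hgD x hx] using (hh01 x).1
  have hμh := (abs_le.1 (abs_integral_sub_le_mul_of_lipschitz hε (by positivity) hhl)).2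
  have hπh : ∫ x, h x ∂π ≤ π.real (Metric.cthickening ρ A) := by
    have hm : MeasurableSet (Metric.cthickening ρ A) := Metric.isClosed_cthickening.measurableSet
    rw [← integral_indicator_one hm]
    refine integral_mono (integrable_of_abs_le hhm (habs h hh01))
      ((integrable_const 1).indicator hm) fun x => ?_
    by_cases hx : x ∈ Metric.cthickening ρ A
    · simpa [hx] using (hh01 x).2
    · simp [hx, hh0 x hx]
  have h1 := abs_le.1 (hdiff μ)
  have h2 := abs_le.1 (hdiff π)
  have h3 := abs_le.1 hfg
  have h4 : 3 * ε / ρ = 2 / ρ * ε + 1 / ρ * ε := by ring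
  rw [h4, abs_le]
  constructor <;> linarith

/-- Quantitative stability of conditioned measures (Lemma on conditional
probabilities): if `∫ D_π dπ ≥ δ`, `μ` and `π` are `ε₁`-close in Wasserstein-1
distance, and `sup |D_π - D_μ| ≤ ε₂`, then for every `ρ ∈ (0,1]`, the tilted
probability measures `μ̃ ∝ D_μ μ` and `π̃ ∝ D_π π` satisfy
`‖μ̃ - π̃‖₁ ≤ (1/δ)(3ε₁/ρ + ε₂ + 2 π(Ā_ρ))`. -/
theorem stmt16 {Y : Type*} [MetricSpace Y] [PolishSpace Y]
    [MeasurableSpace Y] [BorelSpace Y]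
    (hdiam : ∀ x y : Y, dist x y ≤ 1)
    (μ π : Measure Y) [IsProbabilityMeasure μ] [IsProbabilityMeasure π]
    (Dμ Dπ : Y → ℝ) (hDμmeas : Measurable Dμ) (hDπmeas : Measurable Dπ)
    (hDμ01 : ∀ x, Dμ x ∈ Set.Icc (0 : ℝ) 1) (hDπ01 : ∀ x, Dπ x ∈ Set.Icc (0 : ℝ) 1)
    (δ ε₁ ε₂ : ℝ) (hδ : 0 < δ)
    (hδle : δ ≤ ∫ x, Dπ x ∂π)
    (hε₁ : ∀ f : Y → ℝ, LipschitzWith 1 f →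
      |(∫ x, f x ∂μ) - (∫ x, f x ∂π)| ≤ ε₁)
    (hε₂ : ∀ x, |Dπ x - Dμ x| ≤ ε₂)
    (hμpos : 0 < ∫ x, Dμ x ∂μ)
    (ρ : ℝ) (hρ0 : 0 < ρ) (hρ1 : ρ ≤ 1)
    (f : Y → ℝ) (hf : LipschitzWith 1 f) :
    |(∫ x, f x * Dμ x ∂μ) / (∫ x, Dμ x ∂μ)
        - (∫ x, f x * Dπ x ∂π) / (∫ x, Dπ x ∂π)|
      ≤ (1 / δ) * (3 * ε₁ / ρ + ε₂
          + 2 * (π {x : Y | EMetric.infEdist x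
              {z : Y | ∃ y : Y, Dπ z + dist z y / ρ < Dπ y} ≤ ENNReal.ofReal ρ}).toReal) := by
  set Zμ := ∫ x, Dμ x ∂μ
  set Zπ := ∫ x, Dπ x ∂π
  have hZπ : 0 < Zπ := hδ.trans_le hδle
  have habs : ∀ D : Y → ℝ, (∀ x, D x ∈ Set.Icc (0 : ℝ) 1) → ∀ x, |D x| ≤ 1 := fun D hD x => by
    rw [abs_of_nonneg (hD x).1]; exact (hD x).2
  have hDμi : Integrable Dμ μ := integrable_of_abs_le hDμmeas (habs Dμ hDμ01)
  have hDπi : Integrable Dπ π := integrable_of_abs_le hDπmeas (habs Dπ hDπ01)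
  have hfm := hf.continuous.measurable
  have hosc : ∀ x y, |f x - f y| ≤ 1 := fun x y => by
    have := hf.dist_le_mul x y
    rw [NNReal.coe_one, one_mul, Real.dist_eq] at this
    exact this.trans (hdiam x y)
  obtain ⟨x₀⟩ : Nonempty Y := nonempty_of_isProbabilityMeasure μ
  have hfD : ∀ (ν : Measure Y) [IsProbabilityMeasure ν] (D : Y → ℝ), Measurable D →
      (∀ x, D x ∈ Set.Icc (0 : ℝ) 1) → Integrable (fun x => f x * D x) ν := by
    intro ν _ D hDm hD
    refine integrable_of_abs_le (C := (1 + |f x₀|) * 1) (hfm.mul hDm) fun x => ?_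
    rw [abs_mul]
    refine mul_le_mul ?_ (habs D hD x) (abs_nonneg _) (by positivity)
    have := abs_sub_abs_le_abs_sub (f x) (f x₀)
    linarith [hosc x x₀]
  -- Centre `f` at its mean `c` under the tilted measure of `μ`.
  set c := (∫ x, f x * Dμ x ∂μ) / Zμ with hc
  have hcZ : ∫ x, f x * Dμ x ∂μ = c * Zμ := by rw [hc]; field_simp
  have hshift : ∀ (ν : Measure Y) [IsProbabilityMeasure ν] (D : Y → ℝ), Measurable D →
      (∀ x, D x ∈ Set.Icc (0 : ℝ) 1) →
      ∫ x, (f x - c) * D x ∂ν = (∫ x, f x * D x ∂ν) - c * ∫ x, D x ∂ν := by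
    intro ν _ D hDm hD
    simp only [sub_mul]
    rw [integral_sub (hfD ν D hDm hD)
      ((integrable_of_abs_le hDm (habs D hD)).const_mul c), integral_const_mul]
  have hf1 : ∀ x, |f x - c| ≤ 1 := by
    intro x
    have hup : c * Zμ ≤ (f x + 1) * Zμ := by
      rw [← hcZ, ← integral_const_mul]
      refine integral_mono (hfD μ Dμ hDμmeas hDμ01) (hDμi.const_mul _) fun y => ?_
      exact mul_le_mul_of_nonneg_right (by linarith [(abs_le.1 (hosc x y)).1]) (hDμ01 y).1
    have hlo : (f x - 1) * Zμ ≤ c * Zμ := by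
      rw [← hcZ, ← integral_const_mul]
      refine integral_mono (hDμi.const_mul _) (hfD μ Dμ hDμmeas hDμ01) fun y => ?_
      exact mul_le_mul_of_nonneg_right (by linarith [(abs_le.1 (hosc x y)).2]) (hDμ01 y).1
    have h1 := le_of_mul_le_mul_right hup hμpos
    have h2 := le_of_mul_le_mul_right hlo hμpos
    rw [abs_le]
    constructor <;> linarith
  have hfc : LipschitzWith 1 fun x => f x - c := by
    simpa using hf.sub (LipschitzWith.const c)
  have hmain := abs_integral_mul_sub_le hDπmeas hDπ01 hε₁ hρ0 hρ1 hfc hf1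
  set P := Metric.cthickening ρ {z : Y | ∃ y : Y, Dπ z + dist z y / ρ < Dπ y}
  change _ ≤ 1 / δ * (3 * ε₁ / ρ + ε₂ + 2 * π.real P)
  have hDdiff : |(∫ x, (f x - c) * Dπ x ∂μ) - ∫ x, (f x - c) * Dμ x ∂μ| ≤ ε₂ := by
    have hi : ∀ D : Y → ℝ, Measurable D → (∀ x, D x ∈ Set.Icc (0 : ℝ) 1) →
        Integrable (fun x => (f x - c) * D x) μ := fun D hDm hD =>
      integrable_of_abs_le ((hfm.sub_const c).mul hDm) fun x =>
        abs_mul_le_of_abs_le_one (hf1 x) (habs D hD x)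
    rw [← integral_sub (hi Dπ hDπmeas hDπ01) (hi Dμ hDμmeas hDμ01)]
    have := norm_integral_le_of_norm_le_const (μ := μ) (C := ε₂)
      (f := fun x => (f x - c) * Dπ x - (f x - c) * Dμ x) (Filter.Eventually.of_forall fun x => by
        rw [← mul_sub]
        exact abs_mul_le_of_abs_le_one (hf1 x) (hε₂ x))
    simpa using this
  have hzero : ∫ x, (f x - c) * Dμ x ∂μ = 0 := by
    rw [hshift μ Dμ hDμmeas hDμ01, hcZ]
    exact sub_self _
  have hnum : |∫ x, (f x - c) * Dπ x ∂π| ≤ 3 * ε₁ / ρ + ε₂ + 2 * π.real P := by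
    rw [hzero] at hDdiff
    have h1 := abs_le.1 hDdiff
    have h2 := abs_le.1 hmain
    rw [abs_le]
    constructor <;> linarith
  have heq : c - (∫ x, f x * Dπ x ∂π) / Zπ = -((∫ x, (f x - c) * Dπ x ∂π) / Zπ) := by
    rw [hshift π Dπ hDπmeas hDπ01]
    change _ = -((_ - c * Zπ) / Zπ)
    field_simp
    ring
  rw [heq, abs_neg, abs_div, abs_of_pos hZπ, one_div_mul_eq_div]
  exact div_le_div₀ ((abs_nonneg _).trans hnum) hnum hδ hδle
end

section
/- There exists a constant C such that for every λ > 0 there is a probability measure ρ on ℕ × ℕ whose first marginal is I(λ) and whose second marginal is the Poisson distribution with mean λ, satisfying ρ({(u,v) : |u − v| = 1}) ≤ C (1 ∧ λ²) and ρ({(u,v) : |u − v| > 1}) ≤ C (1 ∧ λ³). -/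
open MeasureTheory

/-- The third order tail of a Poisson law with parameter `p ≤ 1` is at most `p ^ 3`. -/
lemma poissonMeasure_Ici_three_le (p : NNReal) (hp1 : p ≤ 1) :
    ProbabilityTheory.poissonMeasure p (Set.Ici 3) ≤ ENNReal.ofReal ((p : ℝ) ^ 3) := by
  set μ := ProbabilityTheory.poissonMeasure p
  have hp0 : (0 : ℝ) ≤ p := p.2
  have hp1' : (p : ℝ) ≤ 1 := by exact_mod_cast hp1
  rw [← ofReal_measureReal]
  apply ENNReal.ofReal_le_ofReal
  have hset : Set.Ici 3 = ((({0, 1, 2} : Finset ℕ) : Set ℕ))ᶜ := by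
    ext k
    simp only [Set.mem_Ici, Finset.coe_insert, Finset.coe_singleton, Set.mem_compl_iff,
      Set.mem_insert_iff, Set.mem_singleton_iff]
    omega
  rw [hset, probReal_compl_eq_one_sub (Finset.measurableSet _), ← sum_measureReal_singleton]
  simp only [μ, ProbabilityTheory.poissonMeasure_real_singleton]
  have hexp := Real.exp_bound' hp0 hp1' (n := 3) (by norm_num)
  have hmul : Real.exp (-(p : ℝ)) * Real.exp p = 1 := by rw [← Real.exp_add]; simp
  have hle : Real.exp (-(p : ℝ)) ≤ 1 := Real.exp_le_one_iff.2 (by linarith)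
  have hpos := Real.exp_pos (-(p : ℝ))
  norm_num [Finset.sum_range_succ, Nat.factorial] at hexp ⊢
  have h1 := mul_le_mul_of_nonneg_left hexp hpos.le
  have h3 : (0 : ℝ) ≤ p ^ 3 := by positivity
  nlinarith [mul_le_mul_of_nonneg_right hle h3]

/-- The second order remainder of `exp (-p)` is bounded by `p ^ 2`. -/
lemma exp_neg_sub_one_add_le_sq {p : ℝ} (hp : 0 ≤ p) : Real.exp (-p) - 1 + p ≤ p ^ 2 := by
  have hmul : Real.exp (-p) * Real.exp p = 1 := by rw [← Real.exp_add]; simp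
  have hpos := Real.exp_pos (-p)
  have h : Real.exp (-p) * (1 + p) ≤ 1 := by
    rw [← hmul]
    gcongr
    linarith [Real.add_one_le_exp p]
  nlinarith [pow_nonneg hp 3]

/-- There is a universal constant `C` such that for every `λ = n + p > 0`
(with `n ∈ ℕ` and `p ∈ (0,1]`) there is a coupling `ρ` of the law `I(λ)`
(which puts mass `1-p` on `n` and mass `p` on `n+1`) and the Poisson
distribution with mean `λ`, such that
`ρ(|u - v| = 1) ≤ C (1 ∧ λ²)` and `ρ(|u - v| > 1) ≤ C (1 ∧ λ³)`. -/
theorem stmt18 :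
    ∃ C : ℝ, 0 < C ∧ ∀ (n : ℕ) (p : ℝ), 0 < p → p ≤ 1 →
      ∃ ρ : Measure (ℕ × ℕ), IsProbabilityMeasure ρ ∧
        (ρ.map Prod.fst) {n} = ENNReal.ofReal (1 - p) ∧
        (ρ.map Prod.fst) {n + 1} = ENNReal.ofReal p ∧
        (∀ k : ℕ, (ρ.map Prod.snd) {k}
          = ENNReal.ofReal (Real.exp (-((n : ℝ) + p)) * ((n : ℝ) + p) ^ k
              / (Nat.factorial k : ℝ))) ∧
        ρ {q : ℕ × ℕ | Nat.dist q.1 q.2 = 1}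
          ≤ ENNReal.ofReal (C * min 1 (((n : ℝ) + p) ^ 2)) ∧
        ρ {q : ℕ × ℕ | 1 < Nat.dist q.1 q.2}
          ≤ ENNReal.ofReal (C * min 1 (((n : ℝ) + p) ^ 3)) := by
  refine ⟨2, two_pos, fun n p hp hp1 ↦ ?_⟩
  have hsum : ENNReal.ofReal (1 - p) + ENNReal.ofReal p = 1 := by
    rw [← ENNReal.ofReal_add (by linarith) hp.le]
    simp
  rcases Nat.eq_zero_or_pos n with rfl | hn
  · simp only [Nat.cast_zero, zero_add]
    set r : NNReal := ⟨p, hp.le⟩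
    set μ := ProbabilityTheory.poissonMeasure r
    have hμ (k : ℕ) : μ {k} = ENNReal.ofReal (Real.exp (-p) * p ^ k / (Nat.factorial k : ℝ)) :=
      ProbabilityTheory.poissonMeasure_singleton r k
    have hμ0 : μ {0} = ENNReal.ofReal (Real.exp (-p)) := by simp [hμ]
    have hc0 : 0 ≤ Real.exp (-p) - 1 + p := by linarith [Real.add_one_le_exp (-p)]
    have he1 : Real.exp (-p) ≤ 1 := Real.exp_le_one_iff.2 (by linarith)
    set ν : Measure ℕ :=
      ENNReal.ofReal (Real.exp (-p) - 1 + p) • Measure.dirac 0 + μ.restrict {0}ᶜ with hν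
    have hνuniv : ν Set.univ = ENNReal.ofReal p := by
      simp only [hν, Measure.coe_add, Pi.add_apply, Measure.smul_apply, measure_univ,
        smul_eq_mul, mul_one, Measure.restrict_apply_univ]
      rw [prob_compl_eq_one_sub (measurableSet_singleton 0), hμ0, ← ENNReal.ofReal_one,
        ← ENNReal.ofReal_sub _ (Real.exp_pos _).le, ← ENNReal.ofReal_add hc0 (by linarith)]
      congr 1
      ring
    set ρ : Measure (ℕ × ℕ) :=
      ENNReal.ofReal (1 - p) • Measure.dirac (0, 0) + ν.map (Prod.mk 1) with hρ
    have hρapp (s : Set (ℕ × ℕ)) :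
        ρ s = ENNReal.ofReal (1 - p) * s.indicator 1 (0, 0) + ν (Prod.mk 1 ⁻¹' s) := by
      simp only [hρ, Measure.coe_add, Pi.add_apply, Measure.smul_apply, smul_eq_mul]
      rw [Measure.dirac_apply' _ (.of_discrete), Measure.map_apply (by fun_prop) (.of_discrete)]
    have hνapp (s : Set ℕ) :
        ν s = ENNReal.ofReal (Real.exp (-p) - 1 + p) * s.indicator 1 0 + μ (s ∩ {0}ᶜ) := by
      simp only [hν, Measure.coe_add, Pi.add_apply, Measure.smul_apply, smul_eq_mul]
      rw [Measure.dirac_apply' _ (.of_discrete), Measure.restrict_apply (.of_discrete)]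
    refine ⟨ρ, ⟨?_⟩, ?_, ?_, fun k ↦ ?_, ?_, ?_⟩
    · simp [hρapp, hνuniv, hsum]
    · rw [Measure.map_apply (by fun_prop) (.of_discrete), hρapp]
      simp [Set.preimage_preimage]
    · rw [Measure.map_apply (by fun_prop) (.of_discrete), hρapp]
      simp [Set.preimage_preimage, hνuniv]
    · rw [Measure.map_apply (by fun_prop) (.of_discrete), hρapp, ← hμ]
      rcases Nat.eq_zero_or_pos k with rfl | hk
      · simp only [Set.preimage_preimage, Set.preimage_id', hνapp, hμ0]
        simp only [Set.inter_compl_self, measure_empty, add_zero]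
        rw [Set.indicator_of_mem (Set.mem_singleton 0),
          Set.indicator_of_mem (show ((0, 0) : ℕ × ℕ) ∈ Prod.snd ⁻¹' {0} from rfl)]
        simp only [Pi.one_apply, mul_one]
        rw [← ENNReal.ofReal_add (by linarith) hc0]
        congr 1
        ring
      · have hset : ({k} : Set ℕ) ∩ {0}ᶜ = {k} := by
          rw [Set.inter_eq_left, Set.singleton_subset_iff]
          exact hk.ne'
        simp [Set.preimage_preimage, Set.preimage_id', hνapp, hset, hk.ne]
    · have hmin : min 1 (p ^ 2) = p ^ 2 := min_eq_right (pow_le_one₀ hp.le hp1)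
      rw [hρapp, hνapp, hmin]
      have hsub : (Prod.mk 1 ⁻¹' {q : ℕ × ℕ | Nat.dist q.1 q.2 = 1}) ∩ {0}ᶜ ⊆ {2} := by
        rintro k ⟨hk, hk0⟩
        simp only [Set.mem_preimage, Set.mem_ofPred_eq, Nat.dist, Set.mem_compl_iff,
          Set.mem_singleton_iff] at hk hk0 ⊢
        omega
      have h2 : μ {2} ≤ ENNReal.ofReal (p ^ 2) := by
        rw [hμ]
        apply ENNReal.ofReal_le_ofReal
        norm_num [Nat.factorial]
        nlinarith [mul_le_mul_of_nonneg_right he1 (sq_nonneg p), sq_nonneg p]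
      have h1 := ENNReal.ofReal_le_ofReal (exp_neg_sub_one_add_le_sq hp.le)
      rw [two_mul, ENNReal.ofReal_add (sq_nonneg p) (sq_nonneg p)]
      refine le_trans (le_of_eq ?_) (add_le_add h1 ((measure_mono hsub).trans h2))
      simp [Nat.dist]
    · have hmin : min 1 (p ^ 3) = p ^ 3 := min_eq_right (pow_le_one₀ hp.le hp1)
      rw [hρapp, hνapp, hmin]
      have hsub : (Prod.mk 1 ⁻¹' {q : ℕ × ℕ | 1 < Nat.dist q.1 q.2}) ∩ {0}ᶜ ⊆ Set.Ici 3 := by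
        rintro k ⟨hk, hk0⟩
        simp only [Set.mem_preimage, Set.mem_ofPred_eq, Nat.dist, Set.mem_compl_iff,
          Set.mem_singleton_iff, Set.mem_Ici] at hk hk0 ⊢
        omega
      have h3 := (measure_mono hsub).trans (poissonMeasure_Ici_three_le r hp1)
      have h4 : ENNReal.ofReal (p ^ 3) ≤ ENNReal.ofReal (2 * p ^ 3) :=
        ENNReal.ofReal_le_ofReal (by nlinarith [pow_pos hp 3])
      simpa [Nat.dist] using h3.trans h4
  · have hn1 : (1 : ℝ) ≤ n := by exact_mod_cast hn
    have hl : 1 ≤ (n : ℝ) + p := by linarith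
    set r : NNReal := ⟨n + p, by linarith⟩
    set μ := ProbabilityTheory.poissonMeasure r
    set β : Measure ℕ :=
      ENNReal.ofReal (1 - p) • Measure.dirac n + ENNReal.ofReal p • Measure.dirac (n + 1) with hβ
    have : IsProbabilityMeasure β := ⟨by simp [hβ, hsum]⟩
    have hone : (1 : ENNReal) ≤ ENNReal.ofReal 2 := by norm_num
    refine ⟨β.prod μ, inferInstance, ?_, ?_, fun k ↦ ?_, ?_, ?_⟩
    · rw [Measure.map_fst_prod]
      simp [hβ]
    · rw [Measure.map_fst_prod]
      simp [hβ]
    · rw [Measure.map_snd_prod]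
      simp only [measure_univ, one_smul]
      exact ProbabilityTheory.poissonMeasure_singleton r k
    · rw [min_eq_left (one_le_pow₀ hl), mul_one]
      exact prob_le_one.trans hone
    · rw [min_eq_left (one_le_pow₀ hl), mul_one]
      exact prob_le_one.trans hone
end

section
/- Let x_1, …, x_N and y_1, …, y_M be points of M, and set μ = ∑_{i=1}^N δ_{x_i} and ν = ∑_{j=1}^M δ_{y_j}. Then sup_{f ∈ Lip_p^0(M)} ( ∑_{i=1}^N f(x_i) − ∑_{j=1}^M f(y_j) ) = min_{σ ∈ S_{N+M}} ∑_{i=1}^{N+M} c(i, σ(i)), where the minimum is over all permutations σ of {1, …, N+M} and the cost is c(i,j) = min( |x_i − y_j|^p , d(x_i, ∂M)^p + d(y_j, ∂M)^p ) if i ≤ N and j ≤ M, c(i,j) = d(x_i, ∂M)^p if i ≤ N and j > M, c(i,j) = d(y_j, ∂M)^p if i > N and j ≤ M, and c(i,j) = 0 if i > N and j > M. -/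
open MeasureTheory Metric

variable {d : ℕ}

/-- The transport cost between the points `x_1, …, x_{N₁}` and `y_1, …, y_{N₂}`
of `M`, where indices beyond the respective ranges represent the boundary
point `Δ`:  `c(i,j) = min(|x_i - y_j|^p, d(x_i,∂M)^p + d(y_j,∂M)^p)` if both
indices are genuine, `c(i,j) = d(x_i,∂M)^p` (resp. `d(y_j,∂M)^p`) if only one
of them is, and `c(i,j) = 0` otherwise. -/
noncomputable def bfCost (S : Set (EuclideanSpace ℝ (Fin d))) (p : ℝ) {N₁ N₂ : ℕ}
    (x : Fin N₁ → EuclideanSpace ℝ (Fin d)) (y : Fin N₂ → EuclideanSpace ℝ (Fin d))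
    (i j : Fin (N₁ + N₂)) : ℝ :=
  if hi : (i : ℕ) < N₁ then
    if hj : (j : ℕ) < N₂ then
      min (dist (x ⟨i, hi⟩) (y ⟨j, hj⟩) ^ p)
        (infDist (x ⟨i, hi⟩) (frontier S) ^ p + infDist (y ⟨j, hj⟩) (frontier S) ^ p)
    else infDist (x ⟨i, hi⟩) (frontier S) ^ p
  else
    if hj : (j : ℕ) < N₂ then infDist (y ⟨j, hj⟩) (frontier S) ^ p
    else 0

/-- Kantorovich duality for a finite assignment problem, in complementary slackness form. -/
theorem exists_potentials_perm {ι : Type*} [Fintype ι] (c : ι → ι → ℝ) :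
    ∃ u v : ι → ℝ, (∀ i j, u i ≤ c i j + v j) ∧
      ∃ σ : Equiv.Perm ι, ∀ i, u i = c i (σ i) + v (σ i) := by
  classical
  rcases isEmpty_or_nonempty ι with hι | hι
  · exact ⟨0, 0, fun i => isEmptyElim i, 1, fun i => isEmptyElim i⟩
  let u : (ι → ℝ) → ι → ℝ := fun v i =>
    Finset.univ.inf' Finset.univ_nonempty (fun j => c i j + v j)
  have hu_le : ∀ v i j, u v i ≤ c i j + v j := fun v i j =>
    Finset.inf'_le (fun j => c i j + v j) (Finset.mem_univ j)
  have le_hu : ∀ v i a, (∀ j, a ≤ c i j + v j) → a ≤ u v i := fun v i a h =>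
    Finset.le_inf' _ _ (fun j _ => h j)
  let g : (ι → ℝ) → ℝ := fun v => ∑ i, u v i - ∑ j, v j
  have hg_cont : Continuous g := by
    refine Continuous.sub (continuous_finsetSum _ fun i _ => ?_) (by fun_prop)
    exact Continuous.finset_inf'_apply _ fun j _ => by fun_prop
  obtain ⟨C, hC⟩ : ∃ C : ℝ, ∀ i j, |c i j| ≤ C := by
    obtain ⟨C, hC⟩ := (Set.finite_range (fun q : ι × ι => |c q.1 q.2|)).bddAbove
    exact ⟨C, fun i j => hC ⟨(i, j), rfl⟩⟩
  have hC0 : 0 ≤ C := (abs_nonneg _).trans (hC hι.some hι.some)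
  set R : ℝ := 2 * (Fintype.card ι * C) with hR
  have hR0 : 0 ≤ R := by positivity
  obtain ⟨v, -, hmax⟩ := (isCompact_Icc (a := (0 : ι → ℝ)) (b := fun _ => R)).exists_isMaxOn
    ⟨0, le_rfl, fun _ => hR0⟩ hg_cont.continuousOn
  have hglobal : ∀ w, g w ≤ g v := by
    intro w
    obtain ⟨k, hk⟩ := Finite.exists_min w
    set w' : ι → ℝ := fun j => w j - w k with hw'
    have hw'0 : ∀ j, 0 ≤ w' j := fun j => sub_nonneg.2 (hk j)
    have hgw : g w ≤ g w' := by
      have h1 : ∀ i, u w i - w k ≤ u w' i := fun i => le_hu _ _ _ fun j => by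
        have := hu_le w i j
        simp only [hw']; linarith
      have h2 := Finset.sum_le_sum fun i (_ : i ∈ Finset.univ) => h1 i
      simp only [g, hw', Finset.sum_sub_distrib] at h2 ⊢
      linarith
    refine hgw.trans ?_
    by_cases hbox : ∀ j, w' j ≤ R
    · exact hmax ⟨hw'0, hbox⟩
    push Not at hbox
    obtain ⟨j, hj⟩ := hbox
    have h0 : g 0 ≤ g v := hmax ⟨le_rfl, fun _ => hR0⟩
    have h0' : -(Fintype.card ι * C) ≤ g 0 := by
      have h1 : ∀ i, -C ≤ u 0 i := fun i => le_hu _ _ _ fun j => by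
        simpa using (abs_le.1 (hC i j)).1
      have h2 := Finset.sum_le_sum fun i (_ : i ∈ Finset.univ) => h1 i
      simpa [g] using h2
    have h3 : ∑ i, u w' i ≤ Fintype.card ι * C := by
      have h1 : ∀ i, u w' i ≤ C := fun i => (hu_le w' i k).trans <| by
        simpa [hw'] using (abs_le.1 (hC i k)).2
      simpa using Finset.sum_le_sum fun i (_ : i ∈ Finset.univ) => h1 i
    have h4 : w' j ≤ ∑ j, w' j :=
      Finset.single_le_sum (fun j _ => hw'0 j) (Finset.mem_univ j)
    simp only [g] at h0 h0' ⊢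
    linarith
  let t : ι → Finset ι := fun i => Finset.univ.filter fun j => u v i = c i j + v j
  have hall : ∀ A : Finset ι, A.card ≤ (A.biUnion t).card := by
    by_contra! hcon
    obtain ⟨A, hA⟩ := hcon
    obtain ⟨ε, hε0, hε⟩ : ∃ ε : ℝ, 0 < ε ∧
        ∀ q : ι × ι, u v q.1 ≠ c q.1 q.2 + v q.2 → u v q.1 + ε ≤ c q.1 q.2 + v q.2 := by
      let slack : ι × ι → ℝ := fun q =>
        if u v q.1 = c q.1 q.2 + v q.2 then 1 else c q.1 q.2 + v q.2 - u v q.1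
      obtain ⟨q, hq⟩ := Finite.exists_min slack
      refine ⟨slack q, ?_, fun r hr => ?_⟩
      · simp only [slack]
        split_ifs with h
        · exact one_pos
        · exact sub_pos.2 (lt_of_le_of_ne (hu_le _ _ _) h)
      · have := hq r
        simp only [slack, if_neg hr] at this ⊢
        linarith
    set w : ι → ℝ := fun j => v j + if j ∈ A.biUnion t then ε else 0 with hw
    have h1 : ∀ i, (u v i + if i ∈ A then ε else 0) ≤ u w i := fun i => le_hu _ _ _ fun j => by
      have := hu_le v i j
      simp only [hw]
      by_cases hi : i ∈ A <;> by_cases hj : j ∈ A.biUnion t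
      · rw [if_pos hi, if_pos hj]; linarith
      · rw [if_pos hi, if_neg hj, add_zero]
        refine hε (i, j) fun h => hj ?_
        exact Finset.mem_biUnion.2 ⟨i, hi, by simpa [t] using h⟩
      · rw [if_neg hi, if_pos hj]; linarith
      · rw [if_neg hi, if_neg hj]; linarith
    have h2 := Finset.sum_le_sum fun i (_ : i ∈ Finset.univ) => h1 i
    have h3 := hglobal w
    have h4 : ((A.biUnion t).card : ℝ) * ε < A.card * ε := by gcongr
    have h5 : ∀ B : Finset ι, ∑ i, (if i ∈ B then ε else 0) = B.card * ε := fun B => by simp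
    simp only [g, hw, Finset.sum_add_distrib, h5] at h2 h3
    linarith
  obtain ⟨f, hf, hft⟩ := (Finset.all_card_le_biUnion_card_iff_exists_injective t).1 hall
  refine ⟨u v, v, hu_le v, Equiv.ofBijective f (Finite.injective_iff_bijective.1 hf), fun i => ?_⟩
  simpa [t] using hft i

/-- The distance `min (|a - b| ^ p) (d(a, T) ^ p + d(b, T) ^ p)` obtained from `dist ^ p`
by collapsing the set `T` to a point. -/
noncomputable def collapsedDist {α : Type*} [PseudoMetricSpace α] (T : Set α) (p : ℝ)
    (a b : α) : ℝ :=
  min (dist a b ^ p) (infDist a T ^ p + infDist b T ^ p)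

section CollapsedDist

variable {α : Type*} [PseudoMetricSpace α] {T : Set α} {p : ℝ}

theorem dist_rpow_triangle (hp0 : 0 ≤ p) (hp1 : p ≤ 1) (a b c : α) :
    dist a c ^ p ≤ dist a b ^ p + dist b c ^ p :=
  (Real.rpow_le_rpow dist_nonneg (dist_triangle a b c) hp0).trans
    (Real.rpow_add_le_add_rpow dist_nonneg dist_nonneg hp0 hp1)

theorem infDist_rpow_nonneg (a : α) : 0 ≤ infDist a T ^ p :=
  Real.rpow_nonneg infDist_nonneg _

theorem infDist_rpow_le_dist_rpow (hp0 : 0 ≤ p) {a z : α} (hz : z ∈ T) :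
    infDist a T ^ p ≤ dist a z ^ p :=
  Real.rpow_le_rpow infDist_nonneg (infDist_le_dist_of_mem hz) hp0

theorem infDist_rpow_le_dist_rpow_add (hp0 : 0 ≤ p) (hp1 : p ≤ 1) (a b : α) :
    infDist a T ^ p ≤ dist a b ^ p + infDist b T ^ p :=
  (Real.rpow_le_rpow infDist_nonneg (infDist_le_infDist_add_dist.trans_eq (add_comm _ _))
    hp0).trans (Real.rpow_add_le_add_rpow dist_nonneg infDist_nonneg hp0 hp1)

theorem collapsedDist_comm (a b : α) : collapsedDist T p a b = collapsedDist T p b a := by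
  rw [collapsedDist, collapsedDist, dist_comm, add_comm]

theorem collapsedDist_self (hp : p ≠ 0) (a : α) : collapsedDist T p a a = 0 := by
  rw [collapsedDist, dist_self, Real.zero_rpow hp]
  exact min_eq_left (add_nonneg (infDist_rpow_nonneg a) (infDist_rpow_nonneg a))

theorem collapsedDist_of_mem_left (hp : 0 < p) {z : α} (hz : z ∈ T) (a : α) :
    collapsedDist T p z a = infDist a T ^ p := by
  rw [collapsedDist, infDist_zero_of_mem hz, Real.zero_rpow hp.ne', zero_add, dist_comm]
  exact min_eq_right (infDist_rpow_le_dist_rpow hp.le hz)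

theorem collapsedDist_of_mem_right (hp : 0 < p) {z : α} (hz : z ∈ T) (a : α) :
    collapsedDist T p a z = infDist a T ^ p := by
  rw [collapsedDist_comm, collapsedDist_of_mem_left hp hz]

theorem collapsedDist_le_dist_rpow_add (hp0 : 0 ≤ p) (hp1 : p ≤ 1) (a b c : α) :
    collapsedDist T p a c ≤ dist a b ^ p + collapsedDist T p b c := by
  simp only [collapsedDist]
  rw [← min_add_add_left]
  refine min_le_min (dist_rpow_triangle hp0 hp1 a b c) ?_
  linarith [infDist_rpow_le_dist_rpow_add (T := T) hp0 hp1 a b]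

theorem sub_le_collapsedDist [ProperSpace α] {U : Set α} (hT : IsClosed T) (hTne : T.Nonempty)
    (hTU : T ⊆ U) {f : α → ℝ} (hf : ∀ a ∈ U, ∀ b ∈ U, |f a - f b| ≤ dist a b ^ p)
    (hf0 : ∀ z ∈ T, f z = 0) {a b : α} (ha : a ∈ U) (hb : b ∈ U) :
    f a - f b ≤ collapsedDist T p a b := by
  have key : ∀ a ∈ U, |f a| ≤ infDist a T ^ p := fun a ha => by
    obtain ⟨z, hz, hza⟩ := hT.exists_infDist_eq_dist hTne a
    simpa [hza, hf0 z hz] using hf a ha z (hTU hz)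
  refine le_min ((le_abs_self _).trans (hf a ha b hb)) ?_
  linarith [le_abs_self (f a), neg_abs_le (f b), key a ha, key b hb]

/-- The inf-convolution of `v` with the collapsed distance, normalised to vanish on `T`, is a
Hölder function that realises the potentials `u` and `v`. -/
theorem exists_holder_of_potentials {ι : Type*} [Fintype ι] (hTne : T.Nonempty)
    (hp0 : 0 < p) (hp1 : p ≤ 1) (X Y : ι → α) (u v : ι → ℝ)
    (huv : ∀ i j, u i ≤ collapsedDist T p (X i) (Y j) + v j) :
    ∃ f : α → ℝ, (∀ a b, |f a - f b| ≤ dist a b ^ p) ∧ (∀ z ∈ T, f z = 0) ∧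
      ∑ i, u i - ∑ i, v i ≤ ∑ i, f (X i) - ∑ i, f (Y i) := by
  rcases isEmpty_or_nonempty ι with hι | hι
  · exact ⟨0, fun a b => by simpa using Real.rpow_nonneg dist_nonneg p, by simp, by simp⟩
  obtain ⟨z₀, hz₀⟩ := hTne
  let h : α → ℝ := fun a =>
    Finset.univ.inf' Finset.univ_nonempty (fun j => collapsedDist T p a (Y j) + v j)
  have h_le : ∀ a j, h a ≤ collapsedDist T p a (Y j) + v j := fun a j =>
    Finset.inf'_le (fun j => collapsedDist T p a (Y j) + v j) (Finset.mem_univ j)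
  have le_h : ∀ a r, (∀ j, r ≤ collapsedDist T p a (Y j) + v j) → r ≤ h a := fun a r hr =>
    Finset.le_inf' _ _ (fun j _ => hr j)
  have h_lip : ∀ a b, h a - h b ≤ dist a b ^ p := fun a b => by
    have : h a - dist a b ^ p ≤ h b := le_h _ _ fun j => by
      linarith [h_le a j, collapsedDist_le_dist_rpow_add (T := T) hp0.le hp1 a b (Y j)]
    linarith
  have h_const : ∀ z ∈ T, h z = h z₀ := fun z hz => by
    simp only [h, collapsedDist_of_mem_left hp0 hz, collapsedDist_of_mem_left hp0 hz₀]
  refine ⟨fun a => h a - h z₀, fun a b => ?_, fun z hz => sub_eq_zero.2 (h_const z hz), ?_⟩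
  · rw [sub_sub_sub_cancel_right, abs_sub_le_iff]
    exact ⟨h_lip a b, dist_comm a b ▸ h_lip b a⟩
  · have hX := Finset.sum_le_sum fun i (_ : i ∈ Finset.univ) => le_h (X i) (u i) (huv i)
    have hY := Finset.sum_le_sum fun j (_ : j ∈ Finset.univ) => h_le (Y j) j
    simp only [collapsedDist_self hp0.ne', zero_add] at hY
    simp only [Finset.sum_sub_distrib]
    linarith

end CollapsedDist

/-- Extend a family indexed by `Fin N` to `Fin n` by the constant value `z`. -/
def padWith {α : Type*} {N : ℕ} (n : ℕ) (x : Fin N → α) (z : α) (k : Fin n) : α :=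
  if h : (k : ℕ) < N then x ⟨k, h⟩ else z

theorem padWith_mem {α : Type*} {N n : ℕ} {x : Fin N → α} {z : α} {U : Set α}
    (hx : ∀ i, x i ∈ U) (hz : z ∈ U) (k : Fin n) : padWith n x z k ∈ U := by
  rw [padWith]
  split_ifs
  exacts [hx _, hz]

theorem sum_padWith {α : Type*} {N n : ℕ} (hn : N ≤ n) (x : Fin N → α) (z : α) {f : α → ℝ}
    (hf : f z = 0) : ∑ k, f (padWith n x z k) = ∑ i, f (x i) := by
  obtain ⟨m, rfl⟩ := Nat.exists_eq_add_of_le hn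
  simp [Fin.sum_univ_add, padWith, hf]

theorem bfCost_eq_collapsedDist {S : Set (EuclideanSpace ℝ (Fin d))} {p : ℝ} (hp : 0 < p)
    {N₁ N₂ : ℕ} (x : Fin N₁ → EuclideanSpace ℝ (Fin d)) (y : Fin N₂ → EuclideanSpace ℝ (Fin d))
    {z : EuclideanSpace ℝ (Fin d)} (hz : z ∈ frontier S) (i j : Fin (N₁ + N₂)) :
    bfCost S p x y i j =
      collapsedDist (frontier S) p (padWith _ x z i) (padWith _ y z j) := by
  simp only [bfCost, padWith]
  split_ifs
  · rfl
  · rw [collapsedDist_of_mem_right hp hz]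
  · rw [collapsedDist_of_mem_left hp hz]
  · rw [collapsedDist_self hp.ne']

/-- Monge–Kantorovich duality for the modified Wasserstein-1 distance `‖μ-ν‖_p`
between the atomic measures `μ = ∑ δ_{x_i}` and `ν = ∑ δ_{y_j}`:
`sup_{f ∈ Lip_p^0(M)} (∑ f(x_i) - ∑ f(y_j)) = min_{σ ∈ S_{N₁+N₂}} ∑ c(i, σ(i))`. -/
theorem stmt19 (S : Set (EuclideanSpace ℝ (Fin d)))
    (hSopen : IsOpen S) (hSconv : Convex ℝ S) (hSne : S.Nonempty)
    (hSproper : S ≠ Set.univ)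
    (p : ℝ) (hp0 : 0 < p) (hp1 : p ≤ 1)
    {N₁ N₂ : ℕ}
    (x : Fin N₁ → EuclideanSpace ℝ (Fin d)) (hx : ∀ i, x i ∈ S)
    (y : Fin N₂ → EuclideanSpace ℝ (Fin d)) (hy : ∀ j, y j ∈ S) :
    sSup {v : ℝ | ∃ f : EuclideanSpace ℝ (Fin d) → ℝ,
        (∀ a ∈ closure S, ∀ b ∈ closure S, |f a - f b| ≤ dist a b ^ p) ∧
        (∀ z ∈ frontier S, f z = 0) ∧
        v = (∑ i, f (x i)) - ∑ j, f (y j)}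
      = ⨅ σ : Equiv.Perm (Fin (N₁ + N₂)), ∑ i, bfCost S p x y i (σ i) := by
  obtain ⟨z, hz⟩ : (frontier S).Nonempty := nonempty_frontier_iff.2 ⟨hSne, hSproper⟩
  set X := padWith (N₁ + N₂) x z
  set Y := padWith (N₁ + N₂) y z
  have hX : ∀ k, X k ∈ closure S :=
    padWith_mem (fun i => subset_closure (hx i)) (frontier_subset_closure hz)
  have hY : ∀ k, Y k ∈ closure S :=
    padWith_mem (fun j => subset_closure (hy j)) (frontier_subset_closure hz)
  simp only [bfCost_eq_collapsedDist hp0 x y hz]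
  have hsum : ∀ f : EuclideanSpace ℝ (Fin d) → ℝ, (∀ w ∈ frontier S, f w = 0) →
      ∑ i, f (x i) - ∑ j, f (y j) = ∑ k, f (X k) - ∑ k, f (Y k) := fun f hf => by
    rw [sum_padWith (Nat.le_add_right _ _) x z (hf z hz),
      sum_padWith (Nat.le_add_left _ _) y z (hf z hz)]
  have weak : ∀ f : EuclideanSpace ℝ (Fin d) → ℝ,
      (∀ a ∈ closure S, ∀ b ∈ closure S, |f a - f b| ≤ dist a b ^ p) →
      (∀ w ∈ frontier S, f w = 0) → ∀ σ : Equiv.Perm (Fin (N₁ + N₂)),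
      ∑ i, f (x i) - ∑ j, f (y j) ≤ ∑ k, collapsedDist (frontier S) p (X k) (Y (σ k)) := by
    intro f hf hf0 σ
    rw [hsum f hf0, ← Equiv.sum_comp σ fun k => f (Y k), ← Finset.sum_sub_distrib]
    exact Finset.sum_le_sum fun k _ => sub_le_collapsedDist isClosed_frontier ⟨z, hz⟩
      frontier_subset_closure hf hf0 (hX k) (hY (σ k))
  obtain ⟨u, v, huv, σ, hσ⟩ :=
    exists_potentials_perm fun i j => collapsedDist (frontier S) p (X i) (Y j)
  obtain ⟨f, hf, hf0, hfuv⟩ := exists_holder_of_potentials ⟨z, hz⟩ hp0 hp1 X Y u v huv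
  have hval : ∑ i, f (x i) - ∑ j, f (y j) =
      ∑ k, collapsedDist (frontier S) p (X k) (Y (σ k)) := by
    refine le_antisymm (weak f (fun a _ b _ => hf a b) hf0 σ) ?_
    rw [hsum f hf0]
    refine le_trans (le_of_eq ?_) hfuv
    rw [← Equiv.sum_comp σ v, ← Finset.sum_sub_distrib]
    exact Finset.sum_congr rfl fun k _ => by linarith [hσ k]
  have hmin : ⨅ τ : Equiv.Perm (Fin (N₁ + N₂)),
      ∑ k, collapsedDist (frontier S) p (X k) (Y (τ k)) = ∑ i, f (x i) - ∑ j, f (y j) :=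
    le_antisymm (hval ▸ ciInf_le (Set.finite_range _).bddBelow σ)
      (le_ciInf (weak f (fun a _ b _ => hf a b) hf0))
  rw [hmin]
  refine IsGreatest.csSup_eq ⟨⟨f, fun a _ b _ => hf a b, hf0, rfl⟩, ?_⟩
  rintro _ ⟨f', hf', hf0', rfl⟩
  exact (weak f' hf' hf0' σ).trans_eq hval.symm
end
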